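/- arXiv:2511.19714 — 10 statements merged into one kernel-verified Lean document; each statement's English description precedes it below -/
import Mathlib

section
/- For every k ≥ 0, the sum of the weighted successive differences satisfies Σ_{s=0}^{k} ( ‖y_{s+1} − y_s‖_Ω² + (1/ρ)·‖v_{s+1} − v_s‖² ) ≤ V_0; equivalently, the running average (1/(k+1))·Σ_{s=0}^{k} ( ‖y_{s+1} − y_s‖_Ω² + (1/ρ)·‖v_{s+1} − v_s‖² ) is at most V_0/(k+1). -/
open scoped RealInnerProductSpace

section InnerProductSpace

variable {E : Type*} [NormedAddCommGroup E] [InnerProductSpace ℝ E]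

theorem LinearMap.IsSymmetric.two_mul_inner_map_sub {T : E →ₗ[ℝ] E} (hT : T.IsSymmetric)
    (a b : E) :
    2 * ⟪T (a - b), a⟫ = ⟪a - b, T (a - b)⟫ + ⟪a, T a⟫ - ⟪b, T b⟫ := by
  have hab : ⟪T b, a⟫ = ⟪b, T a⟫ := hT b a
  have haa : ⟪T a, a⟫ = ⟪a, T a⟫ := hT a a
  have hba : ⟪a, T b⟫ = ⟪T b, a⟫ := real_inner_comm _ _
  simp only [map_sub, inner_sub_left, inner_sub_right]
  linarith

theorem two_mul_inner_sub_self (a b : E) :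
    2 * ⟪a, a - b⟫ = ‖a - b‖ ^ 2 + ‖a‖ ^ 2 - ‖b‖ ^ 2 := by
  rw [norm_sub_sq_real, inner_sub_right, real_inner_self_eq_norm_sq]
  ring

/-- Subgradients of a function are monotone. -/
theorem inner_subgradient_sub_nonneg {G : E → ℝ} {x y g h : E}
    (hg : ∀ z, G x + ⟪g, z - x⟫ ≤ G z) (hh : ∀ z, G y + ⟪h, z - y⟫ ≤ G z) :
    0 ≤ ⟪g - h, x - y⟫ := by
  have hxy := hg y
  rw [← neg_sub x y, inner_neg_right] at hxy
  rw [inner_sub_left]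
  linarith [hh x]

/-- If `S` is symmetric, every vector killed by `S ∘ S` is killed by `S`. -/
theorem LinearMap.IsSymmetric.map_eq_zero_of_map_map_eq_zero {S : E →ₗ[ℝ] E}
    (hS : S.IsSymmetric) {x : E} (hx : S (S x) = 0) : S x = 0 := by
  rw [← inner_self_eq_zero (𝕜 := ℝ), hS x (S x), hx, inner_zero_right]

/-- One step of the linearized method of multipliers decreases the Lyapunov function by at least
the weighted squared length of the step. -/
theorem lyapunov_step {S T : E →ₗ[ℝ] E} (hS : S.IsSymmetric) (hT : T.IsSymmetric)
    {ρ : ℝ} (hρ : 0 < ρ) {G : E → ℝ} {y y' v v' x u g h : E}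
    (hg : ∀ z, G y' + ⟪g, z - y'⟫ ≤ G z) (hh : ∀ z, G x + ⟪h, z - x⟫ ≤ G z)
    (hstep : ⟪S v' - T (y' - y) - g, x - y'⟫ ≤ 0) (hopt : ⟪S u - h, y' - x⟫ ≤ 0)
    (hv : v' = v - ρ • S y') (hx : S x = 0) :
    ⟪y' - y, T (y' - y)⟫ + (1 / ρ) * ‖v' - v‖ ^ 2 +
        (⟪y' - x, T (y' - x)⟫ + (1 / ρ) * ‖v' - u‖ ^ 2) ≤
      ⟪y - x, T (y - x)⟫ + (1 / ρ) * ‖v - u‖ ^ 2 := by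
  have hmono := inner_subgradient_sub_nonneg hg hh
  have hprimal := hT.two_mul_inner_map_sub (y' - x) (y - x)
  have hdual := two_mul_inner_sub_self (v' - u) (v - u)
  rw [sub_sub_sub_cancel_right] at hprimal hdual
  have hcross : (1 / ρ) * ⟪v' - u, v' - v⟫ = -⟪S (v' - u), y' - x⟫ := by
    have hdv : v' - v = -(ρ • S (y' - x)) := by
      rw [map_sub, hx, sub_zero, hv]
      abel
    rw [hdv, inner_neg_right, real_inner_smul_right, hS (v' - u) (y' - x)]
    field_simp
  rw [← neg_sub y' x, inner_neg_right] at hstep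
  simp only [map_sub S, inner_sub_left (𝕜 := ℝ) _ _ (y' - x)] at hstep hopt hmono hcross
  have hdual' := congrArg (fun t => (1 / ρ) * t) hdual
  simp only [mul_sub, mul_add] at hdual'
  linarith

end InnerProductSpace

/-- CONTEXT: consensus optimization in ℝ^N with linearized method of multipliers. -/
theorem stmt_0
    {N : ℕ} (hN : 1 ≤ N)
    (W S : EuclideanSpace ℝ (Fin N) →ₗ[ℝ] EuclideanSpace ℝ (Fin N))
    (hWsymm : ∀ u w : EuclideanSpace ℝ (Fin N), ⟪W u, w⟫ = ⟪u, W w⟫)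
    (hWpsd : ∀ u : EuclideanSpace ℝ (Fin N), 0 ≤ ⟪u, W u⟫)
    (hSsymm : ∀ u w : EuclideanSpace ℝ (Fin N), ⟪S u, w⟫ = ⟪u, S w⟫)
    (hSpsd : ∀ u : EuclideanSpace ℝ (Fin N), 0 ≤ ⟪u, S u⟫)
    (hSS : ∀ u : EuclideanSpace ℝ (Fin N), S (S u) = W u)
    {η ρ : ℝ} (hη : 0 < η) (hρ : 0 < ρ)
    (Ω : EuclideanSpace ℝ (Fin N) →ₗ[ℝ] EuclideanSpace ℝ (Fin N))
    (hΩdef : ∀ u : EuclideanSpace ℝ (Fin N), Ω u = η • u - ρ • W u)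
    (hΩpd : ∀ u : EuclideanSpace ℝ (Fin N), u ≠ 0 → 0 < ⟪u, Ω u⟫)
    (Y : Set (EuclideanSpace ℝ (Fin N))) (hYne : Y.Nonempty) (hYconv : Convex ℝ Y)
    (G : EuclideanSpace ℝ (Fin N) → ℝ) (hGconv : ConvexOn ℝ Set.univ G)
    (y v : ℕ → EuclideanSpace ℝ (Fin N))
    (hyY : ∀ k : ℕ, y k ∈ Y)
    (hstep : ∀ k : ℕ, ∃ g : EuclideanSpace ℝ (Fin N),
      (∀ z : EuclideanSpace ℝ (Fin N), G (y (k+1)) + ⟪g, z - y (k+1)⟫ ≤ G z) ∧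
      (∀ z ∈ Y, ⟪S (v k) - ρ • W (y k) - η • (y (k+1) - y k) - g, z - y (k+1)⟫ ≤ 0))
    (hv : ∀ k : ℕ, v (k+1) = v k - ρ • S (y (k+1)))
    (ystar vstar : EuclideanSpace ℝ (Fin N))
    (hystarY : ystar ∈ Y) (hWystar : W ystar = 0)
    (hKKT : ∃ gstar : EuclideanSpace ℝ (Fin N),
      (∀ z : EuclideanSpace ℝ (Fin N), G ystar + ⟪gstar, z - ystar⟫ ≤ G z) ∧
      (∀ z ∈ Y, ⟪S vstar - gstar, z - ystar⟫ ≤ 0))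
    (V : ℕ → ℝ)
    (hV : ∀ k : ℕ, V k = ⟪y k - ystar, Ω (y k - ystar)⟫ + (1/ρ) * ‖v k - vstar‖^2)
    :
    ∀ k : ℕ,
      ∑ s ∈ Finset.range (k+1),
        (⟪y (s+1) - y s, Ω (y (s+1) - y s)⟫ + (1/ρ) * ‖v (s+1) - v s‖^2) ≤ V 0 := by
  obtain ⟨gstar, hgstar, hopt⟩ := hKKT
  have hΩsymm : Ω.IsSymmetric := fun u w => by
    simp only [hΩdef, inner_sub_left, inner_sub_right, real_inner_smul_left,
      real_inner_smul_right, hWsymm]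
  have hSystar : S ystar = 0 :=
    LinearMap.IsSymmetric.map_eq_zero_of_map_map_eq_zero hSsymm ((hSS ystar).trans hWystar)
  have hdescent : ∀ s, ⟪y (s+1) - y s, Ω (y (s+1) - y s)⟫ + (1/ρ) * ‖v (s+1) - v s‖^2 ≤
      V s - V (s+1) := by
    intro s
    obtain ⟨g, hg, hvar⟩ := hstep s
    have hresidual : S (v s) - ρ • W (y s) - η • (y (s+1) - y s) - g =
        S (v (s+1)) - Ω (y (s+1) - y s) - g := by
      rw [hv s, hΩdef]
      simp only [map_sub, map_smul, hSS, smul_sub]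
      abel
    have hs := hvar ystar hystarY
    rw [hresidual] at hs
    rw [hV s, hV (s+1), le_sub_iff_add_le]
    exact lyapunov_step hSsymm hΩsymm hρ hg hgstar hs (hopt _ (hyY (s+1))) (hv s) hSystar
  have hVnonneg : ∀ s, 0 ≤ V s := by
    intro s
    have hquad : 0 ≤ ⟪y s - ystar, Ω (y s - ystar)⟫ := by
      rcases eq_or_ne (y s - ystar) 0 with h | h
      · simp [h]
      · exact (hΩpd _ h).le
    rw [hV s]
    positivity
  intro k
  have hsum := Finset.sum_le_sum fun s (_ : s ∈ Finset.range (k+1)) => hdescent s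
  rw [Finset.sum_range_sub'] at hsum
  linarith [hVnonneg (k+1)]
end

section
/- For every k ≥ 0, V_{k+1} + ‖y_{k+1} − y_k‖_Ω² + (1/ρ)·‖v_{k+1} − v_k‖² ≤ V_k; in particular the Lyapunov quantity V_k = ‖y_k − y*‖_Ω² + (1/ρ)·‖v_k − v*‖² is nonincreasing in k. -/
open scoped RealInnerProductSpace

/-- Polarization for the quadratic form of a symmetric operator. -/
theorem LinearMap.IsSymmetric.inner_add_inner_sub_sub {E : Type*} [NormedAddCommGroup E]
    [InnerProductSpace ℝ E] {T : E →ₗ[ℝ] E} (hT : T.IsSymmetric) (a b : E) :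
    inner ℝ a (T a) + inner ℝ (a - b) (T (a - b)) - inner ℝ b (T b) =
      2 * inner ℝ (T (a - b)) a := by
  have hab : inner ℝ a (T b) = inner ℝ b (T a) := by rw [← hT a b, real_inner_comm]
  simp only [map_sub, inner_sub_left, inner_sub_right, real_inner_comm _ (T _), hab]
  ring

/-- A subgradient selection of any real function is monotone. -/
theorem inner_sub_nonneg_of_subgradient {E : Type*} [NormedAddCommGroup E]
    [InnerProductSpace ℝ E] {G : E → ℝ} {x x' g g' : E}
    (h : ∀ z, G x + inner ℝ g (z - x) ≤ G z) (h' : ∀ z, G x' + inner ℝ g' (z - x') ≤ G z) :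
    0 ≤ inner ℝ (g - g') (x - x') := by
  have h₁ := h x'
  have h₂ := h' x
  rw [← neg_sub x x', inner_neg_right] at h₁
  rw [inner_sub_left]
  linarith

/-- CONTEXT: consensus optimization in ℝ^N with linearized method of multipliers. -/
theorem stmt_1
    {N : ℕ} (hN : 1 ≤ N)
    (W S : EuclideanSpace ℝ (Fin N) →ₗ[ℝ] EuclideanSpace ℝ (Fin N))
    (hWsymm : ∀ u w : EuclideanSpace ℝ (Fin N), ⟪W u, w⟫ = ⟪u, W w⟫)
    (hWpsd : ∀ u : EuclideanSpace ℝ (Fin N), 0 ≤ ⟪u, W u⟫)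
    (hSsymm : ∀ u w : EuclideanSpace ℝ (Fin N), ⟪S u, w⟫ = ⟪u, S w⟫)
    (hSpsd : ∀ u : EuclideanSpace ℝ (Fin N), 0 ≤ ⟪u, S u⟫)
    (hSS : ∀ u : EuclideanSpace ℝ (Fin N), S (S u) = W u)
    {η ρ : ℝ} (hη : 0 < η) (hρ : 0 < ρ)
    (Ω : EuclideanSpace ℝ (Fin N) →ₗ[ℝ] EuclideanSpace ℝ (Fin N))
    (hΩdef : ∀ u : EuclideanSpace ℝ (Fin N), Ω u = η • u - ρ • W u)
    (hΩpd : ∀ u : EuclideanSpace ℝ (Fin N), u ≠ 0 → 0 < ⟪u, Ω u⟫)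
    (Y : Set (EuclideanSpace ℝ (Fin N))) (hYne : Y.Nonempty) (hYconv : Convex ℝ Y)
    (G : EuclideanSpace ℝ (Fin N) → ℝ) (hGconv : ConvexOn ℝ Set.univ G)
    (y v : ℕ → EuclideanSpace ℝ (Fin N))
    (hyY : ∀ k : ℕ, y k ∈ Y)
    (hstep : ∀ k : ℕ, ∃ g : EuclideanSpace ℝ (Fin N),
      (∀ z : EuclideanSpace ℝ (Fin N), G (y (k+1)) + ⟪g, z - y (k+1)⟫ ≤ G z) ∧
      (∀ z ∈ Y, ⟪S (v k) - ρ • W (y k) - η • (y (k+1) - y k) - g, z - y (k+1)⟫ ≤ 0))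
    (hv : ∀ k : ℕ, v (k+1) = v k - ρ • S (y (k+1)))
    (ystar vstar : EuclideanSpace ℝ (Fin N))
    (hystarY : ystar ∈ Y) (hWystar : W ystar = 0)
    (hKKT : ∃ gstar : EuclideanSpace ℝ (Fin N),
      (∀ z : EuclideanSpace ℝ (Fin N), G ystar + ⟪gstar, z - ystar⟫ ≤ G z) ∧
      (∀ z ∈ Y, ⟪S vstar - gstar, z - ystar⟫ ≤ 0))
    (V : ℕ → ℝ)
    (hV : ∀ k : ℕ, V k = ⟪y k - ystar, Ω (y k - ystar)⟫ + (1/ρ) * ‖v k - vstar‖^2)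
    :
    (∀ k : ℕ,
      V (k+1) + ⟪y (k+1) - y k, Ω (y (k+1) - y k)⟫ + (1/ρ) * ‖v (k+1) - v k‖^2 ≤ V k) ∧
    (∀ k : ℕ, V (k+1) ≤ V k) := by
  have hΩsymm : Ω.IsSymmetric := fun u w => by
    simp only [hΩdef, inner_sub_left, inner_sub_right, real_inner_smul_left,
      real_inner_smul_right, hWsymm]
  have hΩnonneg : ∀ u, 0 ≤ ⟪u, Ω u⟫ := fun u => by
    rcases eq_or_ne u 0 with rfl | hu
    · simp
    · exact (hΩpd u hu).le
  have hSystar : S ystar = 0 := by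
    rw [← inner_self_eq_zero (𝕜 := ℝ), hSsymm, hSS, hWystar, inner_zero_right]
  have descent : ∀ k : ℕ,
      V (k+1) + ⟪y (k+1) - y k, Ω (y (k+1) - y k)⟫ + (1/ρ) * ‖v (k+1) - v k‖^2 ≤ V k := by
    intro k
    obtain ⟨g, hg, hopt⟩ := hstep k
    obtain ⟨gstar, hgstar, hoptstar⟩ := hKKT
    have hmono := inner_sub_nonneg_of_subgradient hg hgstar
    have hprimal := hopt ystar hystarY
    rw [← neg_sub (y (k+1)) ystar, inner_neg_right] at hprimal
    have hstar := hoptstar (y (k+1)) (hyY (k+1))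
    have hresidual : S (v k) - ρ • W (y k) - η • (y (k+1) - y k) - g =
        S (v (k+1) - vstar) - Ω (y (k+1) - y k) + (S vstar - gstar) - (g - gstar) := by
      simp only [hv, hΩdef, map_sub, map_smul, hSS]
      module
    have hdual : ⟪S (v (k+1) - vstar), y (k+1) - ystar⟫ =
        -(1/ρ) * ⟪v (k+1) - vstar, v (k+1) - v k⟫ := by
      have hdiff : v (k+1) - v k = -(ρ • S (y (k+1))) := by rw [hv]; abel
      rw [hdiff, hSsymm, map_sub, hSystar, sub_zero, inner_neg_right, real_inner_smul_right]
      field_simp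
    have hkey : ⟪Ω (y (k+1) - y k), y (k+1) - ystar⟫ +
        (1/ρ) * ⟪v (k+1) - vstar, v (k+1) - v k⟫ ≤ 0 := by
      rw [hresidual, inner_sub_left, inner_add_left, inner_sub_left, hdual] at hprimal
      linarith
    have hΩpolar := hΩsymm.inner_add_inner_sub_sub (y (k+1) - ystar) (y k - ystar)
    rw [sub_sub_sub_cancel_right] at hΩpolar
    have hvpolar : ‖v k - vstar‖^2 = ‖v (k+1) - vstar‖^2 -
        2 * ⟪v (k+1) - vstar, v (k+1) - v k⟫ + ‖v (k+1) - v k‖^2 := by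
      rw [← norm_sub_sq_real, sub_sub_sub_cancel_left, ← norm_neg, neg_sub, norm_sub_rev]
    rw [hV, hV, hvpolar]
    linarith
  refine ⟨descent, fun k => ?_⟩
  have hv_nonneg : 0 ≤ (1/ρ) * ‖v (k+1) - v k‖^2 := by positivity
  linarith [descent k, hΩnonneg (y (k+1) - y k)]
end

section
/- For every k ≥ 1, the last successive difference obeys the non-ergodic sublinear rate ‖y_{k+1} − y_k‖_Ω² + (1/ρ)·‖v_{k+1} − v_k‖² ≤ V_0 / k; in particular the weighted difference norm decays like O(1/√k). -/
open scoped RealInnerProductSpace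

section InnerProductSpace

variable {E : Type*} [NormedAddCommGroup E] [InnerProductSpace ℝ E]

/-- The sum of the subdifferential of `G` and the normal cone of `Y` is monotone. -/
theorem inner_sub_nonneg_of_subgradient_of_normal {G : E → ℝ} {Y : Set E} {x₁ x₂ p₁ p₂ : E}
    (hx₁ : x₁ ∈ Y) (hx₂ : x₂ ∈ Y)
    (h₁ : ∃ g, (∀ z, G x₁ + ⟪g, z - x₁⟫ ≤ G z) ∧ ∀ z ∈ Y, ⟪p₁ - g, z - x₁⟫ ≤ 0)
    (h₂ : ∃ g, (∀ z, G x₂ + ⟪g, z - x₂⟫ ≤ G z) ∧ ∀ z ∈ Y, ⟪p₂ - g, z - x₂⟫ ≤ 0) :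
    0 ≤ ⟪p₁ - p₂, x₁ - x₂⟫ := by
  obtain ⟨g₁, hg₁, hn₁⟩ := h₁
  obtain ⟨g₂, hg₂, hn₂⟩ := h₂
  have e₁ := hg₁ x₂
  have e₂ := hg₂ x₁
  have e₃ := hn₁ x₂ hx₂
  have e₄ := hn₂ x₁ hx₁
  simp only [inner_sub_left, inner_sub_right] at *
  linarith

/-- Three-point inequality for the squared seminorm of a symmetric operator `Ω`, paired with a
scaled norm. -/
theorem three_point_le {Ω : E →ₗ[ℝ] E} (hΩ : ∀ u w, ⟪Ω u, w⟫ = ⟪u, Ω w⟫) {c : ℝ} {a a' b b' : E}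
    (h : ⟪Ω (a' - a), a'⟫ + c * ⟪b' - b, b'⟫ ≤ 0) :
    ⟪a', Ω a'⟫ + c * ‖b'‖ ^ 2 + (⟪a' - a, Ω (a' - a)⟫ + c * ‖b' - b‖ ^ 2) ≤
      ⟪a, Ω a⟫ + c * ‖b‖ ^ 2 := by
  have e : ⟪a, Ω a'⟫ = ⟪a', Ω a⟫ := by rw [← hΩ, real_inner_comm]
  simp only [← real_inner_self_eq_norm_sq, map_sub, inner_sub_left, inner_sub_right, hΩ,
    real_inner_comm b b'] at h ⊢
  rw [e] at *
  linarith

end InnerProductSpace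

/-- If `V` is nonnegative and decreases by at least `d k` at step `k`, with `d` antitone, then
`d k ≤ V 0 / k`. -/
theorem le_div_of_antitone_of_add_le {V d : ℕ → ℝ} (hd : Antitone d)
    (hV0 : ∀ k, 0 ≤ V k) (hVd : ∀ k, V (k + 1) + d k ≤ V k) {k : ℕ} (hk : 1 ≤ k) :
    d k ≤ V 0 / k := by
  have hsum : ∀ n, V n + ∑ i ∈ Finset.range n, d i ≤ V 0 := by
    intro n
    induction n with
    | zero => simp
    | succ n ih =>
      rw [Finset.sum_range_succ]
      linarith [hVd n]
  have hle : (k : ℝ) * d k ≤ ∑ i ∈ Finset.range k, d i := by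
    simpa using Finset.card_nsmul_le_sum (Finset.range k) d (d k)
      fun i hi => hd (Finset.mem_range.1 hi).le
  rw [le_div_iff₀ (by exact_mod_cast hk)]
  linarith [hsum k, hV0 k]

/-- CONTEXT: consensus optimization in ℝ^N with linearized method of multipliers. -/
theorem stmt_3
    {N : ℕ} (hN : 1 ≤ N)
    (W S : EuclideanSpace ℝ (Fin N) →ₗ[ℝ] EuclideanSpace ℝ (Fin N))
    (hWsymm : ∀ u w : EuclideanSpace ℝ (Fin N), ⟪W u, w⟫ = ⟪u, W w⟫)
    (hWpsd : ∀ u : EuclideanSpace ℝ (Fin N), 0 ≤ ⟪u, W u⟫)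
    (hSsymm : ∀ u w : EuclideanSpace ℝ (Fin N), ⟪S u, w⟫ = ⟪u, S w⟫)
    (hSpsd : ∀ u : EuclideanSpace ℝ (Fin N), 0 ≤ ⟪u, S u⟫)
    (hSS : ∀ u : EuclideanSpace ℝ (Fin N), S (S u) = W u)
    {η ρ : ℝ} (hη : 0 < η) (hρ : 0 < ρ)
    (Ω : EuclideanSpace ℝ (Fin N) →ₗ[ℝ] EuclideanSpace ℝ (Fin N))
    (hΩdef : ∀ u : EuclideanSpace ℝ (Fin N), Ω u = η • u - ρ • W u)
    (hΩpd : ∀ u : EuclideanSpace ℝ (Fin N), u ≠ 0 → 0 < ⟪u, Ω u⟫)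
    (Y : Set (EuclideanSpace ℝ (Fin N))) (hYne : Y.Nonempty) (hYconv : Convex ℝ Y)
    (G : EuclideanSpace ℝ (Fin N) → ℝ) (hGconv : ConvexOn ℝ Set.univ G)
    (y v : ℕ → EuclideanSpace ℝ (Fin N))
    (hyY : ∀ k : ℕ, y k ∈ Y)
    (hstep : ∀ k : ℕ, ∃ g : EuclideanSpace ℝ (Fin N),
      (∀ z : EuclideanSpace ℝ (Fin N), G (y (k+1)) + ⟪g, z - y (k+1)⟫ ≤ G z) ∧
      (∀ z ∈ Y, ⟪S (v k) - ρ • W (y k) - η • (y (k+1) - y k) - g, z - y (k+1)⟫ ≤ 0))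
    (hv : ∀ k : ℕ, v (k+1) = v k - ρ • S (y (k+1)))
    (ystar vstar : EuclideanSpace ℝ (Fin N))
    (hystarY : ystar ∈ Y) (hWystar : W ystar = 0)
    (hKKT : ∃ gstar : EuclideanSpace ℝ (Fin N),
      (∀ z : EuclideanSpace ℝ (Fin N), G ystar + ⟪gstar, z - ystar⟫ ≤ G z) ∧
      (∀ z ∈ Y, ⟪S vstar - gstar, z - ystar⟫ ≤ 0))
    (V : ℕ → ℝ)
    (hV : ∀ k : ℕ, V k = ⟪y k - ystar, Ω (y k - ystar)⟫ + (1/ρ) * ‖v k - vstar‖^2)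
    :
    ∀ k : ℕ, 1 ≤ k →
      ⟪y (k+1) - y k, Ω (y (k+1) - y k)⟫ + (1/ρ) * ‖v (k+1) - v k‖^2 ≤ V 0 / (k : ℝ) := by
  intro k hk
  have hΩsymm : ∀ u w, ⟪Ω u, w⟫ = ⟪u, Ω w⟫ := by
    intro u w
    simp only [hΩdef, inner_sub_left, inner_sub_right, real_inner_smul_left,
      real_inner_smul_right, hWsymm]
  have hΩnonneg : ∀ u, 0 ≤ ⟪u, Ω u⟫ := by
    intro u
    rcases eq_or_ne u 0 with rfl | hu
    · simp
    · exact (hΩpd u hu).le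
  have hSystar : S ystar = 0 := by
    rw [← inner_self_eq_zero (𝕜 := ℝ), hSsymm, hSS, hWystar, inner_zero_right]
  have hSy : ∀ k, S (y (k + 1)) = -((1 / ρ) • (v (k + 1) - v k)) := by
    intro k
    rw [hv k, sub_sub_cancel_left, smul_neg, neg_neg, smul_smul, one_div_mul_cancel hρ.ne',
      one_smul]
  have hopt : ∀ k, ∃ g, (∀ z, G (y (k + 1)) + ⟪g, z - y (k + 1)⟫ ≤ G z) ∧
      ∀ z ∈ Y, ⟪S (v (k + 1)) - Ω (y (k + 1) - y k) - g, z - y (k + 1)⟫ ≤ 0 := by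
    intro k
    have e : S (v (k + 1)) - Ω (y (k + 1) - y k) =
        S (v k) - ρ • W (y k) - η • (y (k + 1) - y k) := by
      rw [hv k, hΩdef, map_sub, map_smul, hSS, map_sub]
      module
    rw [e]
    exact hstep k
  have hdescent : ∀ k, V (k + 1) +
      (⟪y (k + 1) - y k, Ω (y (k + 1) - y k)⟫ + 1 / ρ * ‖v (k + 1) - v k‖ ^ 2) ≤ V k := by
    intro k
    have hmono := inner_sub_nonneg_of_subgradient_of_normal (hyY (k + 1)) hystarY (hopt k) hKKT
    have hkey : ⟪Ω (y (k + 1) - ystar - (y k - ystar)), y (k + 1) - ystar⟫ +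
        1 / ρ * ⟪v (k + 1) - vstar - (v k - vstar), v (k + 1) - vstar⟫ ≤ 0 := by
      have e : ⟪S (v (k + 1) - vstar), y (k + 1) - ystar⟫ =
          -(1 / ρ * ⟪v (k + 1) - v k, v (k + 1) - vstar⟫) := by
        rw [hSsymm, map_sub S (y (k + 1)), hSystar, hSy, sub_zero, inner_neg_right,
          real_inner_smul_right, real_inner_comm]
      rw [sub_right_comm, ← map_sub, inner_sub_left, e] at hmono
      simp only [sub_sub_sub_cancel_right]
      linarith
    have h := three_point_le hΩsymm hkey
    rw [hV, hV]
    simpa only [sub_sub_sub_cancel_right] using h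
  refine le_div_of_antitone_of_add_le (V := V)
    (d := fun k => ⟪y (k + 1) - y k, Ω (y (k + 1) - y k)⟫ + 1 / ρ * ‖v (k + 1) - v k‖ ^ 2)
    (antitone_nat_of_succ_le fun k => ?_) (fun k => ?_) hdescent hk
  · have hmono := inner_sub_nonneg_of_subgradient_of_normal (hyY (k + 1 + 1)) (hyY (k + 1))
      (hopt (k + 1)) (hopt k)
    have hkey : ⟪Ω (y (k + 1 + 1) - y (k + 1) - (y (k + 1) - y k)), y (k + 1 + 1) - y (k + 1)⟫ +
        1 / ρ * ⟪v (k + 1 + 1) - v (k + 1) - (v (k + 1) - v k), v (k + 1 + 1) - v (k + 1)⟫ ≤ 0 := by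
      have e : ⟪S (v (k + 1 + 1) - v (k + 1)), y (k + 1 + 1) - y (k + 1)⟫ =
          -(1 / ρ * ⟪v (k + 1 + 1) - v (k + 1) - (v (k + 1) - v k),
            v (k + 1 + 1) - v (k + 1)⟫) := by
        rw [hSsymm, map_sub S (y (k + 1 + 1)), hSy, hSy, ← neg_sub', ← smul_sub,
          inner_neg_right, real_inner_smul_right, real_inner_comm]
      rw [sub_sub_sub_comm, ← map_sub, ← map_sub, inner_sub_left, e] at hmono
      linarith
    have h := three_point_le hΩsymm hkey
    have h₀ := hΩnonneg (y (k + 1 + 1) - y (k + 1) - (y (k + 1) - y k))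
    have h₁ : 0 ≤ 1 / ρ * ‖v (k + 1 + 1) - v (k + 1) - (v (k + 1) - v k)‖ ^ 2 := by positivity
    linarith
  · rw [hV]
    exact add_nonneg (hΩnonneg _) (by positivity)
end

section
/- For every k ≥ 0, if g_{k+1} is any subgradient of G at y_{k+1} satisfying condition (i) and g* is any subgradient of G at y* satisfying the KKT condition, then 0 ≤ ⟪g_{k+1} − g*, y_{k+1} − y*⟫ ≤ (1/2)·( V_k − V_{k+1} − ‖y_{k+1} − y_k‖_Ω² − (1/ρ)·‖v_{k+1} − v_k‖² ). -/
open scoped RealInnerProductSpace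

section

variable {E : Type*} [NormedAddCommGroup E] [InnerProductSpace ℝ E]

/-- Monotonicity of the subdifferential. -/
theorem inner_sub_subgradient_nonneg {G : E → ℝ} {x y g h : E}
    (hg : ∀ z, G x + inner ℝ g (z - x) ≤ G z) (hh : ∀ z, G y + inner ℝ h (z - y) ≤ G z) :
    0 ≤ inner ℝ (g - h) (x - y) := by
  have h₁ := hg y
  have h₂ := hh x
  rw [← neg_sub x y, inner_neg_right] at h₁
  rw [inner_sub_left]
  linarith

/-- The three-point identity for a symmetric bilinear form `⟪·, A ·⟫`. -/
theorem LinearMap.IsSymmetric.inner_sub_map_sub {A : E →ₗ[ℝ] E} (hA : A.IsSymmetric) (d e : E) :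
    inner ℝ (d - e) (A (d - e)) =
      inner ℝ d (A d) - 2 * inner ℝ e (A d) + inner ℝ e (A e) := by
  have h : inner ℝ d (A e) = inner ℝ e (A d) := by rw [← hA d e, real_inner_comm]
  simp only [map_sub, inner_sub_left, inner_sub_right, h]
  ring

end

/-- CONTEXT: consensus optimization in ℝ^N with linearized method of multipliers. -/
theorem stmt_4
    {N : ℕ} (hN : 1 ≤ N)
    (W S : EuclideanSpace ℝ (Fin N) →ₗ[ℝ] EuclideanSpace ℝ (Fin N))
    (hWsymm : ∀ u w : EuclideanSpace ℝ (Fin N), ⟪W u, w⟫ = ⟪u, W w⟫)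
    (hWpsd : ∀ u : EuclideanSpace ℝ (Fin N), 0 ≤ ⟪u, W u⟫)
    (hSsymm : ∀ u w : EuclideanSpace ℝ (Fin N), ⟪S u, w⟫ = ⟪u, S w⟫)
    (hSpsd : ∀ u : EuclideanSpace ℝ (Fin N), 0 ≤ ⟪u, S u⟫)
    (hSS : ∀ u : EuclideanSpace ℝ (Fin N), S (S u) = W u)
    {η ρ : ℝ} (hη : 0 < η) (hρ : 0 < ρ)
    (Ω : EuclideanSpace ℝ (Fin N) →ₗ[ℝ] EuclideanSpace ℝ (Fin N))
    (hΩdef : ∀ u : EuclideanSpace ℝ (Fin N), Ω u = η • u - ρ • W u)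
    (hΩpd : ∀ u : EuclideanSpace ℝ (Fin N), u ≠ 0 → 0 < ⟪u, Ω u⟫)
    (Y : Set (EuclideanSpace ℝ (Fin N))) (hYne : Y.Nonempty) (hYconv : Convex ℝ Y)
    (G : EuclideanSpace ℝ (Fin N) → ℝ) (hGconv : ConvexOn ℝ Set.univ G)
    (y v : ℕ → EuclideanSpace ℝ (Fin N))
    (hyY : ∀ k : ℕ, y k ∈ Y)
    (hstep : ∀ k : ℕ, ∃ g : EuclideanSpace ℝ (Fin N),
      (∀ z : EuclideanSpace ℝ (Fin N), G (y (k+1)) + ⟪g, z - y (k+1)⟫ ≤ G z) ∧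
      (∀ z ∈ Y, ⟪S (v k) - ρ • W (y k) - η • (y (k+1) - y k) - g, z - y (k+1)⟫ ≤ 0))
    (hv : ∀ k : ℕ, v (k+1) = v k - ρ • S (y (k+1)))
    (ystar vstar : EuclideanSpace ℝ (Fin N))
    (hystarY : ystar ∈ Y) (hWystar : W ystar = 0)
    (hKKT : ∃ gstar : EuclideanSpace ℝ (Fin N),
      (∀ z : EuclideanSpace ℝ (Fin N), G ystar + ⟪gstar, z - ystar⟫ ≤ G z) ∧
      (∀ z ∈ Y, ⟪S vstar - gstar, z - ystar⟫ ≤ 0))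
    (V : ℕ → ℝ)
    (hV : ∀ k : ℕ, V k = ⟪y k - ystar, Ω (y k - ystar)⟫ + (1/ρ) * ‖v k - vstar‖^2)
    :
    ∀ k : ℕ, ∀ g gstar : EuclideanSpace ℝ (Fin N),
      (∀ z : EuclideanSpace ℝ (Fin N), G (y (k+1)) + ⟪g, z - y (k+1)⟫ ≤ G z) →
      (∀ z ∈ Y, ⟪S (v k) - ρ • W (y k) - η • (y (k+1) - y k) - g, z - y (k+1)⟫ ≤ 0) →
      (∀ z : EuclideanSpace ℝ (Fin N), G ystar + ⟪gstar, z - ystar⟫ ≤ G z) →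
      (∀ z ∈ Y, ⟪S vstar - gstar, z - ystar⟫ ≤ 0) →
      0 ≤ ⟪g - gstar, y (k+1) - ystar⟫ ∧
      ⟪g - gstar, y (k+1) - ystar⟫ ≤
        (1/2) * (V k - V (k+1) - ⟪y (k+1) - y k, Ω (y (k+1) - y k)⟫
          - (1/ρ) * ‖v (k+1) - v k‖^2) := by
  intro k g gstar hg hgVI hgstar hgstarVI
  refine ⟨inner_sub_subgradient_nonneg hg hgstar, ?_⟩
  have hSystar : S ystar = 0 :=
    LinearMap.IsSymmetric.map_eq_zero_of_map_map_eq_zero hSsymm (by rw [hSS, hWystar])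
  have hΩsymm : Ω.IsSymmetric := fun u w => by
    simp only [hΩdef, inner_sub_left, inner_sub_right, real_inner_smul_left,
      real_inner_smul_right, hWsymm]
  have h₁ := hgVI ystar hystarY
  have h₂ := hgstarVI (y (k+1)) (hyY (k+1))
  rw [hV, hV, hv]
  obtain ⟨d, hd⟩ : ∃ d, d = y (k+1) - ystar := ⟨_, rfl⟩
  obtain ⟨e, he⟩ : ∃ e, e = y (k+1) - y k := ⟨_, rfl⟩
  obtain ⟨p, hp⟩ : ∃ p, p = v k - vstar := ⟨_, rfl⟩
  have hyk : y k - ystar = d - e := by rw [hd, he]; abel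
  have hWyk : W (y k) = W d - W e := by rw [← map_sub, ← hyk, map_sub, hWystar, sub_zero]
  have hSy : S (y (k+1)) = S d := by rw [hd, map_sub, hSystar, sub_zero]
  have hvk : v k = p + vstar := by rw [hp]; abel
  have hneg : ystar - y (k+1) = -d := by rw [hd]; abel
  have hp' : p + vstar - ρ • S d - vstar = p - ρ • S d := by abel
  have hp'' : p + vstar - ρ • S d - (p + vstar) = -(ρ • S d) := by abel
  rw [hneg, hWyk, ← he, hvk] at h₁
  rw [← hd] at h₂
  rw [hyk, ← hd, ← he, hSy, hvk, hp', hp'', add_sub_cancel_right,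
    hΩsymm.inner_sub_map_sub, norm_sub_sq_real, norm_neg, norm_smul, mul_pow,
    Real.norm_eq_abs, sq_abs, real_inner_smul_right]
  have hdual : (1/2) * ((1/ρ) * ‖p‖^2
      - (1/ρ) * (‖p‖^2 - 2 * (ρ * ⟪p, S d⟫) + ρ^2 * ‖S d‖^2) - (1/ρ) * (ρ^2 * ‖S d‖^2))
      = ⟪p, S d⟫ - ρ * ‖S d‖^2 := by
    field_simp
    ring
  have hWd : ⟪d, W d⟫ = ‖S d‖^2 := by rw [← hSS, ← hSsymm, real_inner_self_eq_norm_sq]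
  have hΩed : ⟪e, Ω d⟫ = η * ⟪e, d⟫ - ρ * ⟪e, W d⟫ := by
    rw [hΩdef, inner_sub_right, real_inner_smul_right, real_inner_smul_right]
  simp only [map_add, inner_neg_right, inner_sub_left, inner_add_left, real_inner_smul_left,
    smul_sub, hWsymm, hSsymm, hWd] at h₁ h₂ ⊢
  linarith
end

section
/- Assume additionally that g* = S·v*, i.e., S·v* is itself a subgradient of G at y*. Then for every k ≥ 1 the objective error satisfies the non-ergodic bound G(y_{k+1}) − G(y*) ≤ (1/√k)·( V_0 + ‖v*‖·√(V_0/ρ) ). -/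
open scoped RealInnerProductSpace

section Energy

variable {E : Type*} [NormedAddCommGroup E] [InnerProductSpace ℝ E]

/-- The squared norm `‖a‖_Ω² + ρ⁻¹ ‖p‖²` on primal-dual pairs. -/
noncomputable def energy (Ω : E →ₗ[ℝ] E) (ρ : ℝ) (a p : E) : ℝ :=
  ⟪a, Ω a⟫ + (1 / ρ) * ‖p‖ ^ 2

/-- The bilinear form polarizing `energy`. -/
noncomputable def energyForm (Ω : E →ₗ[ℝ] E) (ρ : ℝ) (a p b q : E) : ℝ :=
  ⟪a, Ω b⟫ + (1 / ρ) * ⟪p, q⟫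

variable {Ω : E →ₗ[ℝ] E} {ρ : ℝ}

lemma energy_nonneg (hΩ : ∀ u, 0 ≤ ⟪u, Ω u⟫) (hρ : 0 < ρ) (a p : E) : 0 ≤ energy Ω ρ a p := by
  have := hΩ a
  unfold energy
  positivity

lemma energy_add_smul (hΩ : ∀ u w, ⟪Ω u, w⟫ = ⟪u, Ω w⟫) (a p b q : E) (t : ℝ) :
    energy Ω ρ (a + t • b) (p + t • q) =
      energy Ω ρ a p + 2 * t * energyForm Ω ρ a p b q + t ^ 2 * energy Ω ρ b q := by
  have h : ⟪b, Ω a⟫ = ⟪a, Ω b⟫ := by rw [← hΩ, real_inner_comm]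
  simp only [energy, energyForm, ← real_inner_self_eq_norm_sq, map_add, map_smul, inner_add_left,
    inner_add_right, real_inner_smul_left, real_inner_smul_right, h, real_inner_comm p q]
  ring

lemma energy_add_energy_sub_le (hΩ : ∀ u w, ⟪Ω u, w⟫ = ⟪u, Ω w⟫) {a p b q : E}
    (h : energyForm Ω ρ a p (a - b) (p - q) ≤ 0) :
    energy Ω ρ a p + energy Ω ρ (a - b) (p - q) ≤ energy Ω ρ b q := by
  have := energy_add_smul (ρ := ρ) hΩ a p (a - b) (p - q) (-1)
  simp only [neg_smul, one_smul, neg_sub, add_sub_cancel] at this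
  linarith

lemma neg_energyForm_le (hΩ : ∀ u w, ⟪Ω u, w⟫ = ⟪u, Ω w⟫) (hΩ' : ∀ u, 0 ≤ ⟪u, Ω u⟫)
    (hρ : 0 < ρ) (a p b q : E) {t : ℝ} (ht : 0 < t) :
    -energyForm Ω ρ a p b q ≤ (energy Ω ρ a p / t + t * energy Ω ρ b q) / 2 := by
  have h := energy_nonneg hΩ' hρ (a + t • b) (p + t • q)
  rw [energy_add_smul hΩ] at h
  have h2 : 0 ≤ (energy Ω ρ a p + 2 * t * energyForm Ω ρ a p b q + t ^ 2 * energy Ω ρ b q) / t :=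
    div_nonneg h ht.le
  have h3 : (energy Ω ρ a p + 2 * t * energyForm Ω ρ a p b q + t ^ 2 * energy Ω ρ b q) / t =
      energy Ω ρ a p / t + 2 * energyForm Ω ρ a p b q + t * energy Ω ρ b q := by
    field_simp
  linarith

lemma norm_sq_le_mul_energy (hΩ : ∀ u, 0 ≤ ⟪u, Ω u⟫) (hρ : 0 < ρ) (a p : E) :
    ‖p‖ ^ 2 ≤ ρ * energy Ω ρ a p := by
  have h := mul_nonneg hρ.le (hΩ a)
  have h2 : ρ * energy Ω ρ a p = ρ * ⟪a, Ω a⟫ + ‖p‖ ^ 2 := by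
    unfold energy
    field_simp
  linarith

end Energy

/-- An antitone sequence whose terms are dominated by the decrements of a nonnegative
sequence `V` decays at rate `V 0 / k`. -/
lemma natCast_mul_le_of_antitone {V D : ℕ → ℝ} (hV : ∀ k, 0 ≤ V k) (hD : Antitone D)
    (h : ∀ k, V (k + 1) + D k ≤ V k) (k : ℕ) : k * D k ≤ V 0 := by
  have hsum : ∀ n : ℕ, n * D n + V n ≤ V 0 := by
    intro n
    induction n with
    | zero => simp
    | succ n ih =>
      have h1 := hD (Nat.le_succ n)
      have h2 := h n
      have h3 : ((n : ℝ) + 1) * D (n + 1) ≤ (n + 1) * D n :=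
        mul_le_mul_of_nonneg_left h1 (by positivity)
      push_cast
      linarith
  have := hsum k
  have := hV k
  linarith

/-- CONTEXT: consensus optimization in ℝ^N with linearized method of multipliers. -/
theorem stmt_5
    {N : ℕ} (hN : 1 ≤ N)
    (W S : EuclideanSpace ℝ (Fin N) →ₗ[ℝ] EuclideanSpace ℝ (Fin N))
    (hWsymm : ∀ u w : EuclideanSpace ℝ (Fin N), ⟪W u, w⟫ = ⟪u, W w⟫)
    (hWpsd : ∀ u : EuclideanSpace ℝ (Fin N), 0 ≤ ⟪u, W u⟫)
    (hSsymm : ∀ u w : EuclideanSpace ℝ (Fin N), ⟪S u, w⟫ = ⟪u, S w⟫)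
    (hSpsd : ∀ u : EuclideanSpace ℝ (Fin N), 0 ≤ ⟪u, S u⟫)
    (hSS : ∀ u : EuclideanSpace ℝ (Fin N), S (S u) = W u)
    {η ρ : ℝ} (hη : 0 < η) (hρ : 0 < ρ)
    (Ω : EuclideanSpace ℝ (Fin N) →ₗ[ℝ] EuclideanSpace ℝ (Fin N))
    (hΩdef : ∀ u : EuclideanSpace ℝ (Fin N), Ω u = η • u - ρ • W u)
    (hΩpd : ∀ u : EuclideanSpace ℝ (Fin N), u ≠ 0 → 0 < ⟪u, Ω u⟫)
    (Y : Set (EuclideanSpace ℝ (Fin N))) (hYne : Y.Nonempty) (hYconv : Convex ℝ Y)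
    (G : EuclideanSpace ℝ (Fin N) → ℝ) (hGconv : ConvexOn ℝ Set.univ G)
    (y v : ℕ → EuclideanSpace ℝ (Fin N))
    (hyY : ∀ k : ℕ, y k ∈ Y)
    (hstep : ∀ k : ℕ, ∃ g : EuclideanSpace ℝ (Fin N),
      (∀ z : EuclideanSpace ℝ (Fin N), G (y (k+1)) + ⟪g, z - y (k+1)⟫ ≤ G z) ∧
      (∀ z ∈ Y, ⟪S (v k) - ρ • W (y k) - η • (y (k+1) - y k) - g, z - y (k+1)⟫ ≤ 0))
    (hv : ∀ k : ℕ, v (k+1) = v k - ρ • S (y (k+1)))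
    (ystar vstar : EuclideanSpace ℝ (Fin N))
    (hystarY : ystar ∈ Y) (hWystar : W ystar = 0)
    (hKKT : ∃ gstar : EuclideanSpace ℝ (Fin N),
      (∀ z : EuclideanSpace ℝ (Fin N), G ystar + ⟪gstar, z - ystar⟫ ≤ G z) ∧
      (∀ z ∈ Y, ⟪S vstar - gstar, z - ystar⟫ ≤ 0))
    (hgstar : ∀ z : EuclideanSpace ℝ (Fin N), G ystar + ⟪S vstar, z - ystar⟫ ≤ G z)
    (V₀ : ℝ)
    (hV₀ : V₀ = ⟪y 0 - ystar, Ω (y 0 - ystar)⟫ + (1/ρ) * ‖v 0 - vstar‖^2) :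
    ∀ k : ℕ, 1 ≤ k →
      G (y (k+1)) - G ystar ≤
        (1 / Real.sqrt (k : ℝ)) * (V₀ + ‖vstar‖ * Real.sqrt (V₀ / ρ)) := by
  have hΩsymm : ∀ u w, ⟪Ω u, w⟫ = ⟪u, Ω w⟫ := by
    intro u w
    simp only [hΩdef, inner_sub_left, inner_sub_right, real_inner_smul_left,
      real_inner_smul_right, hWsymm]
  have hΩnn : ∀ u, 0 ≤ ⟪u, Ω u⟫ := by
    intro u
    rcases eq_or_ne u 0 with rfl | hu
    · simp
    · exact (hΩpd u hu).le
  have hSystar : S ystar = 0 := by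
    rw [← inner_self_eq_zero (𝕜 := ℝ), hSsymm, hSS, hWystar, inner_zero_right]
  have hSy : ∀ k, S (y (k + 1)) = -(1 / ρ) • (v (k + 1) - v k) := by
    intro k
    rw [hv, sub_sub_cancel_left, smul_neg, neg_smul, neg_neg, smul_smul, one_div,
      inv_mul_cancel₀ hρ.ne', one_smul]
  have hdir : ∀ k, S (v k) - ρ • W (y k) - η • (y (k + 1) - y k) =
      S (v (k + 1)) - Ω (y (k + 1) - y k) := by
    intro k
    rw [hv, hΩdef]
    simp only [map_sub, map_smul, hSS, smul_sub]
    abel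
  choose g hsub hnormal using hstep
  simp only [hdir] at hnormal
  have hpair : ∀ k (p : EuclideanSpace ℝ (Fin N)),
      ⟪S p, y (k + 1) - ystar⟫ = -((1 / ρ) * ⟪p, v (k + 1) - v k⟫) := by
    intro k p
    rw [hSsymm, map_sub, hSystar, sub_zero, hSy, real_inner_smul_right]
    ring
  have hgap : ∀ k, G (y (k + 1)) - G ystar ≤
      -energyForm Ω ρ (y (k + 1) - ystar) (v (k + 1) - vstar) (y (k + 1) - y k)
        (v (k + 1) - v k) - (1 / ρ) * ⟪vstar, v (k + 1) - v k⟫ := by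
    intro k
    have h1 := hsub k ystar
    have h2 := hnormal k ystar hystarY
    have h3 := hpair k (v (k + 1))
    rw [← neg_sub (y (k + 1)) ystar, inner_neg_right] at h1 h2
    rw [inner_sub_left, inner_sub_left, h3, real_inner_comm (y (k + 1) - ystar) (Ω _)] at h2
    rw [energyForm, inner_sub_left (v (k + 1)) vstar]
    linarith
  have hgap_ge : ∀ k, -((1 / ρ) * ⟪vstar, v (k + 1) - v k⟫) ≤ G (y (k + 1)) - G ystar := by
    intro k
    have h1 := hgstar (y (k + 1))
    rw [hpair] at h1
    linarith
  set V : ℕ → ℝ := fun k => energy Ω ρ (y k - ystar) (v k - vstar) with hVdef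
  set D : ℕ → ℝ := fun k => energy Ω ρ (y (k + 1) - y k) (v (k + 1) - v k) with hDdef
  have hVnn : ∀ k, 0 ≤ V k := fun k => energy_nonneg hΩnn hρ _ _
  have hDnn : ∀ k, 0 ≤ D k := fun k => energy_nonneg hΩnn hρ _ _
  have hV0 : V 0 = V₀ := hV₀.symm
  have hdecr : ∀ k, V (k + 1) + D k ≤ V k := by
    intro k
    have h := energy_add_energy_sub_le (ρ := ρ) hΩsymm (a := y (k + 1) - ystar)
      (p := v (k + 1) - vstar) (b := y k - ystar) (q := v k - vstar)
    simp only [sub_sub_sub_cancel_right] at h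
    exact h (by linarith [hgap k, hgap_ge k])
  have hDanti : Antitone D := by
    refine antitone_nat_of_succ_le fun k => ?_
    have h := energy_add_energy_sub_le (ρ := ρ) hΩsymm (a := y (k + 1 + 1) - y (k + 1))
      (p := v (k + 1 + 1) - v (k + 1)) (b := y (k + 1) - y k) (q := v (k + 1) - v k) ?_
    · have := energy_nonneg hΩnn hρ (y (k + 1 + 1) - y (k + 1) - (y (k + 1) - y k))
        (v (k + 1 + 1) - v (k + 1) - (v (k + 1) - v k))
      simp only [hDdef]
      linarith
    · have h1 := hsub k (y (k + 1 + 1))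
      have h2 := hsub (k + 1) (y (k + 1))
      have h3 := hnormal k (y (k + 1 + 1)) (hyY _)
      have h4 := hnormal (k + 1) (y (k + 1)) (hyY _)
      rw [← neg_sub (y (k + 1 + 1)) (y (k + 1)), inner_neg_right] at h2 h4
      have h5 : ⟪S (v (k + 1 + 1)) - S (v (k + 1)), y (k + 1 + 1) - y (k + 1)⟫ =
          -((1 / ρ) * ⟪v (k + 1 + 1) - v (k + 1),
            v (k + 1 + 1) - v (k + 1) - (v (k + 1) - v k)⟫) := by
        rw [← map_sub, hSsymm, map_sub, hSy, hSy, ← smul_sub, real_inner_smul_right]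
        ring
      rw [energyForm, map_sub, inner_sub_right, ← real_inner_comm _ (Ω (y (k + 1 + 1) - y (k + 1))),
        ← real_inner_comm _ (Ω (y (k + 1) - y k))]
      simp only [inner_sub_left (𝕜 := ℝ) (S _)] at h5
      simp only [inner_sub_left (𝕜 := ℝ) (_ - _) (g _), inner_sub_left (𝕜 := ℝ) (S _)] at h3 h4
      linarith
  intro k hk
  have hk0 : (0 : ℝ) < k := by exact_mod_cast hk
  have ht : 0 < √(k : ℝ) := Real.sqrt_pos.2 hk0
  have htt : √(k : ℝ) * √(k : ℝ) = k := Real.mul_self_sqrt hk0.le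
  have hrate : k * D k ≤ V₀ := hV0 ▸ natCast_mul_le_of_antitone hVnn hDanti hdecr k
  have hVle : V (k + 1) ≤ V₀ := by
    rw [← hV0]
    exact antitone_nat_of_succ_le (fun n => by linarith [hdecr n, hDnn n]) (Nat.zero_le _)
  have hcross := neg_energyForm_le hΩsymm hΩnn hρ (y (k + 1) - ystar) (v (k + 1) - vstar)
    (y (k + 1) - y k) (v (k + 1) - v k) ht
  have hfirst : V (k + 1) / √(k : ℝ) ≤ V₀ / √(k : ℝ) := by gcongr
  have hsecond : √(k : ℝ) * D k ≤ V₀ / √(k : ℝ) := by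
    rw [le_div_iff₀ ht]
    linear_combination hrate + D k * htt
  have hnorm : (1 / ρ) * ‖v (k + 1) - v k‖ ≤ (1 / √(k : ℝ)) * √(V₀ / ρ) := by
    have hsq : ‖v (k + 1) - v k‖ ^ 2 ≤ ρ * D k := norm_sq_le_mul_energy hΩnn hρ _ _
    rw [one_div_mul_eq_div √(k : ℝ), ← Real.sqrt_div' _ hk0.le]
    apply Real.le_sqrt_of_sq_le
    rw [mul_pow, div_div, le_div_iff₀ (by positivity)]
    calc (1 / ρ) ^ 2 * ‖v (k + 1) - v k‖ ^ 2 * (ρ * k)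
        ≤ (1 / ρ) ^ 2 * (ρ * D k) * (ρ * k) := by gcongr
      _ = k * D k := by field_simp
      _ ≤ V₀ := hrate
  have hdual : -((1 / ρ) * ⟪vstar, v (k + 1) - v k⟫) ≤
      (1 / √(k : ℝ)) * (‖vstar‖ * √(V₀ / ρ)) := by
    calc -((1 / ρ) * ⟪vstar, v (k + 1) - v k⟫)
        = (1 / ρ) * -⟪vstar, v (k + 1) - v k⟫ := by ring
      _ ≤ (1 / ρ) * (‖vstar‖ * ‖v (k + 1) - v k‖) := by
          gcongr
          exact (neg_le_abs _).trans (abs_real_inner_le_norm _ _)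
      _ = ‖vstar‖ * ((1 / ρ) * ‖v (k + 1) - v k‖) := by ring
      _ ≤ ‖vstar‖ * ((1 / √(k : ℝ)) * √(V₀ / ρ)) := by gcongr
      _ = _ := by ring
  rw [mul_add, one_div_mul_eq_div √(k : ℝ) V₀]
  linarith [hgap k]
end

section
/- For every k ≥ 1 the objective error is bounded from below by G(y_{k+1}) − G(y*) ≥ −(1/√k)·‖v*‖·√(V_0/ρ). -/
open scoped RealInnerProductSpace

section Auxiliary

variable {E : Type*} [NormedAddCommGroup E] [InnerProductSpace ℝ E]

/-- `p` lies in the sum of the subdifferential of `G` and the normal cone of `Y` at `x`. -/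
def IsConstrainedSubgradient (G : E → ℝ) (Y : Set E) (x p : E) : Prop :=
  ∃ g : E, (∀ z, G x + ⟪g, z - x⟫ ≤ G z) ∧ ∀ z ∈ Y, ⟪p - g, z - x⟫ ≤ 0

theorem IsConstrainedSubgradient.add_inner_le {G : E → ℝ} {Y : Set E} {x p z : E}
    (h : IsConstrainedSubgradient G Y x p) (hz : z ∈ Y) : G x + ⟪p, z - x⟫ ≤ G z := by
  obtain ⟨g, hg, hp⟩ := h
  have h₁ := hg z
  have h₂ := hp z hz
  rw [inner_sub_left] at h₂
  linarith

theorem IsConstrainedSubgradient.monotone {G : E → ℝ} {Y : Set E} {x x' p p' : E}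
    (h : IsConstrainedSubgradient G Y x p) (h' : IsConstrainedSubgradient G Y x' p')
    (hx : x ∈ Y) (hx' : x' ∈ Y) : 0 ≤ ⟪p - p', x - x'⟫ := by
  have h₁ := h.add_inner_le hx'
  have h₂ := h'.add_inner_le hx
  rw [← neg_sub x x', inner_neg_right] at h₁
  rw [inner_sub_left]
  linarith

/-- The squared norm on pairs in which the primal-dual iteration is a proximal point step. -/
noncomputable def primalDualEnergy (Ω : E →ₗ[ℝ] E) (ρ : ℝ) (a b : E) : ℝ :=
  ⟪a, Ω a⟫ + (1 / ρ) * ‖b‖ ^ 2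

theorem primalDualEnergy_nonneg {Ω : E →ₗ[ℝ] E} {ρ : ℝ} (hρ : 0 < ρ)
    (hΩ : Ω.IsPositive) (a b : E) : 0 ≤ primalDualEnergy Ω ρ a b :=
  add_nonneg (hΩ.inner_nonneg_right a) (by positivity)

theorem primalDualEnergy_add_le {S Ω : E →ₗ[ℝ] E} (hS : S.IsSymmetric) (hΩ : Ω.IsSymmetric)
    {ρ : ℝ} (hρ : 0 < ρ) {a a' b b' : E} (hb : b = b' - ρ • S a)
    (h : 0 ≤ ⟪S b - Ω (a - a'), a⟫) :
    primalDualEnergy Ω ρ a b + primalDualEnergy Ω ρ (a - a') (b - b') ≤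
      primalDualEnergy Ω ρ a' b' := by
  have hdual : ‖b‖ ^ 2 + ‖b - b'‖ ^ 2 = ‖b'‖ ^ 2 - 2 * ρ * ⟪b, S a⟫ := by
    have hb' : b' = b + ρ • S a := by rw [hb]; abel
    have hd : b - b' = -(ρ • S a) := by rw [hb']; abel
    rw [hd, norm_neg, hb', norm_add_sq_real, inner_smul_right]
    ring
  have hΩa : ⟪a, Ω a'⟫ = ⟪a', Ω a⟫ := by rw [← hΩ a a', real_inner_comm]
  rw [inner_sub_left, hS b a, hΩ, inner_sub_left] at h
  have hρ' : (1 / ρ) * (2 * ρ * ⟪b, S a⟫) = 2 * ⟪b, S a⟫ := by field_simp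
  have hdual' := congrArg (fun t => (1 / ρ) * t) hdual
  simp only [mul_add, mul_sub, hρ'] at hdual'
  simp only [primalDualEnergy, map_sub, inner_sub_left, inner_sub_right]
  linarith

/-- If a nonnegative sequence `V` decreases by at least `D k` at step `k` and `D` is antitone,
then `D k ≤ V 0 / (k + 1)`. -/
theorem succ_mul_le_of_antitone_of_add_le {V D : ℕ → ℝ} (hV : ∀ k, 0 ≤ V k)
    (hD : Antitone D) (h : ∀ k, V (k + 1) + D k ≤ V k) (k : ℕ) :
    (k + 1) * D k ≤ V 0 := by
  have hsum : ∀ n, V n + ∑ i ∈ Finset.range n, D i ≤ V 0 := by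
    intro n
    induction n with
    | zero => simp
    | succ n ih => rw [Finset.sum_range_succ]; linarith [h n]
  have hcard : (Finset.range (k + 1)).card • D k ≤ ∑ i ∈ Finset.range (k + 1), D i :=
    Finset.card_nsmul_le_sum _ _ _ fun i hi => hD (by simpa [Nat.lt_succ_iff] using hi)
  simp only [Finset.card_range, nsmul_eq_mul, Nat.cast_add, Nat.cast_one] at hcard
  linarith [hsum (k + 1), hV (k + 1)]

end Auxiliary

/-- CONTEXT: consensus optimization in ℝ^N with linearized method of multipliers. -/
theorem stmt_6
    {N : ℕ} (hN : 1 ≤ N)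
    (W S : EuclideanSpace ℝ (Fin N) →ₗ[ℝ] EuclideanSpace ℝ (Fin N))
    (hWsymm : ∀ u w : EuclideanSpace ℝ (Fin N), ⟪W u, w⟫ = ⟪u, W w⟫)
    (hWpsd : ∀ u : EuclideanSpace ℝ (Fin N), 0 ≤ ⟪u, W u⟫)
    (hSsymm : ∀ u w : EuclideanSpace ℝ (Fin N), ⟪S u, w⟫ = ⟪u, S w⟫)
    (hSpsd : ∀ u : EuclideanSpace ℝ (Fin N), 0 ≤ ⟪u, S u⟫)
    (hSS : ∀ u : EuclideanSpace ℝ (Fin N), S (S u) = W u)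
    {η ρ : ℝ} (hη : 0 < η) (hρ : 0 < ρ)
    (Ω : EuclideanSpace ℝ (Fin N) →ₗ[ℝ] EuclideanSpace ℝ (Fin N))
    (hΩdef : ∀ u : EuclideanSpace ℝ (Fin N), Ω u = η • u - ρ • W u)
    (hΩpd : ∀ u : EuclideanSpace ℝ (Fin N), u ≠ 0 → 0 < ⟪u, Ω u⟫)
    (Y : Set (EuclideanSpace ℝ (Fin N))) (hYne : Y.Nonempty) (hYconv : Convex ℝ Y)
    (G : EuclideanSpace ℝ (Fin N) → ℝ) (hGconv : ConvexOn ℝ Set.univ G)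
    (y v : ℕ → EuclideanSpace ℝ (Fin N))
    (hyY : ∀ k : ℕ, y k ∈ Y)
    (hstep : ∀ k : ℕ, ∃ g : EuclideanSpace ℝ (Fin N),
      (∀ z : EuclideanSpace ℝ (Fin N), G (y (k+1)) + ⟪g, z - y (k+1)⟫ ≤ G z) ∧
      (∀ z ∈ Y, ⟪S (v k) - ρ • W (y k) - η • (y (k+1) - y k) - g, z - y (k+1)⟫ ≤ 0))
    (hv : ∀ k : ℕ, v (k+1) = v k - ρ • S (y (k+1)))
    (ystar vstar : EuclideanSpace ℝ (Fin N))
    (hystarY : ystar ∈ Y) (hWystar : W ystar = 0)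
    (hKKT : ∃ gstar : EuclideanSpace ℝ (Fin N),
      (∀ z : EuclideanSpace ℝ (Fin N), G ystar + ⟪gstar, z - ystar⟫ ≤ G z) ∧
      (∀ z ∈ Y, ⟪S vstar - gstar, z - ystar⟫ ≤ 0))
    (V₀ : ℝ)
    (hV₀ : V₀ = ⟪y 0 - ystar, Ω (y 0 - ystar)⟫ + (1/ρ) * ‖v 0 - vstar‖^2) :
    ∀ k : ℕ, 1 ≤ k →
      -(1 / Real.sqrt (k : ℝ)) * (‖vstar‖ * Real.sqrt (V₀ / ρ)) ≤ G (y (k+1)) - G ystar := by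
  have hΩpos : Ω.IsPositive := by
    refine ⟨fun u w => ?_, fun u => ?_⟩
    · simp only [hΩdef, inner_sub_left, inner_sub_right, inner_smul_left, inner_smul_right, hWsymm]
      simp
    · rcases eq_or_ne u 0 with rfl | hu
      · simp
      · simpa [real_inner_comm] using (hΩpd u hu).le
  have hSystar : S ystar = 0 := by
    rw [← inner_self_eq_zero (𝕜 := ℝ), hSsymm, hSS, hWystar, inner_zero_right]
  have hsub (k : ℕ) : IsConstrainedSubgradient G Y (y (k + 1))
      (S (v (k + 1)) - Ω (y (k + 1) - y k)) := by
    obtain ⟨g, hg, hp⟩ := hstep k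
    have heq : S (v (k + 1)) - Ω (y (k + 1) - y k) =
        S (v k) - ρ • W (y k) - η • (y (k + 1) - y k) := by
      simp only [hv k, hΩdef, map_sub, map_smul, hSS, smul_sub]
      abel
    exact ⟨g, hg, by rwa [heq]⟩
  have hV (k : ℕ) : primalDualEnergy Ω ρ (y (k + 1) - ystar) (v (k + 1) - vstar) +
      primalDualEnergy Ω ρ (y (k + 1) - y k) (v (k + 1) - v k) ≤
        primalDualEnergy Ω ρ (y k - ystar) (v k - vstar) := by
    have hb : v (k + 1) - vstar = v k - vstar - ρ • S (y (k + 1) - ystar) := by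
      rw [hv k, map_sub, hSystar, sub_zero]; abel
    have hmono := (hsub k).monotone hKKT (hyY _) hystarY
    rw [sub_right_comm, ← map_sub] at hmono
    rw [← sub_sub_sub_cancel_right (y (k + 1)) (y k) ystar] at hmono
    simpa using primalDualEnergy_add_le hSsymm hΩpos.isSymmetric hρ hb hmono
  have hD : Antitone fun k => primalDualEnergy Ω ρ (y (k + 1) - y k) (v (k + 1) - v k) := by
    refine antitone_nat_of_succ_le fun k => ?_
    have hb : v (k + 1 + 1) - v (k + 1) =
        v (k + 1) - v k - ρ • S (y (k + 1 + 1) - y (k + 1)) := by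
      rw [hv (k + 1), hv k, map_sub, smul_sub]; abel
    have hmono := (hsub (k + 1)).monotone (hsub k) (hyY _) (hyY _)
    rw [sub_sub_sub_comm, ← map_sub, ← map_sub] at hmono
    have hle := primalDualEnergy_add_le hSsymm hΩpos.isSymmetric hρ hb hmono
    exact (le_add_of_nonneg_right (primalDualEnergy_nonneg hρ hΩpos _ _)).trans hle
  intro k hk
  have hk0 : (0 : ℝ) < k := by exact_mod_cast hk
  have hrate := succ_mul_le_of_antitone_of_add_le
    (V := fun k => primalDualEnergy Ω ρ (y k - ystar) (v k - vstar))
    (fun _ => primalDualEnergy_nonneg hρ hΩpos _ _) hD hV k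
  have hres : ρ * ‖S (y (k + 1))‖ ^ 2 ≤
      primalDualEnergy Ω ρ (y (k + 1) - y k) (v (k + 1) - v k) := by
    have hvk : v (k + 1) - v k = -(ρ • S (y (k + 1))) := by rw [hv k]; abel
    have hsq : (1 / ρ) * ‖v (k + 1) - v k‖ ^ 2 = ρ * ‖S (y (k + 1))‖ ^ 2 := by
      rw [hvk, norm_neg, norm_smul, Real.norm_of_nonneg hρ.le]; field_simp
    rw [primalDualEnergy, hsq]
    exact le_add_of_nonneg_left (hΩpos.inner_nonneg_right _)
  have hbound : ‖S (y (k + 1))‖ ≤ 1 / Real.sqrt k * Real.sqrt (V₀ / ρ) := by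
    rw [one_div, ← Real.sqrt_inv, ← Real.sqrt_mul (by positivity)]
    refine Real.le_sqrt_of_sq_le ?_
    have hV₀' : (k : ℝ) * (ρ * ‖S (y (k + 1))‖ ^ 2) ≤ V₀ := by
      have hp : 0 ≤ ρ * ‖S (y (k + 1))‖ ^ 2 := by positivity
      have hm := mul_le_mul_of_nonneg_left hres (by positivity : (0 : ℝ) ≤ k + 1)
      have hV₀e : V₀ = primalDualEnergy Ω ρ (y 0 - ystar) (v 0 - vstar) := hV₀
      linarith
    rw [inv_mul_eq_div, div_div, le_div_iff₀ (by positivity)]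
    linarith
  have hlow := IsConstrainedSubgradient.add_inner_le hKKT (hyY (k + 1))
  rw [hSsymm, map_sub, hSystar, sub_zero] at hlow
  have hcs := neg_le_of_abs_le (abs_real_inner_le_norm vstar (S (y (k + 1))))
  have hmul := mul_le_mul_of_nonneg_left hbound (norm_nonneg vstar)
  linarith
end

section
/- For every k ≥ 1 the global cost of the economic dispatch iterates satisfies the non-ergodic upper bound f(x_{k+1}) − f(x*) ≤ (1/√k)·( V_0 + ‖y*‖_Ω·√V_0 ). -/
open scoped RealInnerProductSpace

/-- First-order optimality condition for minimizing a convex function plus a scaled squared norm. -/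
lemma le_add_inner_of_forall_add_norm_sq_le {E : Type*} [NormedAddCommGroup E]
    [InnerProductSpace ℝ E] {f : E → ℝ} (hf : ConvexOn ℝ Set.univ f) {C : Set E}
    (hC : Convex ℝ C) {η : ℝ} (hη : 0 < η) {a x : E} (hx : x ∈ C)
    (hmin : ∀ ξ ∈ C, f x + (η / 2) * ‖a + η⁻¹ • x‖ ^ 2 ≤ f ξ + (η / 2) * ‖a + η⁻¹ • ξ‖ ^ 2)
    {ξ : E} (hξ : ξ ∈ C) : f x ≤ f ξ + ⟪a + η⁻¹ • x, ξ - x⟫ := by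
  set b := a + η⁻¹ • x
  set c := ‖ξ - x‖ ^ 2 / (2 * η)
  have key : ∀ t : ℝ, 0 < t → t ≤ 1 → f x ≤ f ξ + ⟪b, ξ - x⟫ + t * c := by
    intro t ht ht1
    have hmem := hC hx hξ (sub_nonneg.2 ht1) ht.le (by ring)
    have hconv := hf.2 (Set.mem_univ x) (Set.mem_univ ξ) (sub_nonneg.2 ht1) ht.le (by ring)
    have h := hmin _ hmem
    have hpt : a + η⁻¹ • ((1 - t) • x + t • ξ) = b + (η⁻¹ * t) • (ξ - x) := by
      simp only [b]; module
    rw [hpt, norm_add_sq_real b, norm_smul, mul_pow, real_inner_smul_right, Real.norm_eq_abs,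
      sq_abs] at h
    simp only [smul_eq_mul] at hconv
    have hexp : η / 2 * (‖b‖ ^ 2 + 2 * (η⁻¹ * t * ⟪b, ξ - x⟫) + (η⁻¹ * t) ^ 2 * ‖ξ - x‖ ^ 2)
        = η / 2 * ‖b‖ ^ 2 + t * (⟪b, ξ - x⟫ + t * c) := by
      simp only [c]; field_simp
      ring
    have : 0 ≤ t * (f ξ + ⟪b, ξ - x⟫ + t * c - f x) := by linarith
    linarith [nonneg_of_mul_nonneg_right this ht]
  have hlim : Filter.Tendsto (fun t : ℝ => f ξ + ⟪b, ξ - x⟫ + t * c) (nhdsWithin 0 (Set.Ioi 0))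
      (nhds (f ξ + ⟪b, ξ - x⟫ + 0 * c)) :=
    (Continuous.tendsto (by fun_prop) 0).mono_left nhdsWithin_le_nhds
  rw [zero_mul, add_zero] at hlim
  refine ge_of_tendsto hlim ?_
  filter_upwards [Ioc_mem_nhdsGT (zero_lt_one' ℝ)] with t ht using key t ht.1 ht.2

namespace LinearMap.BilinForm

variable {Z : Type*} [AddCommGroup Z] [Module ℝ Z] {B : LinearMap.BilinForm ℝ Z}

lemma neg_apply_le_sqrt_mul_sqrt (hB : B.IsSymm) (hpos : ∀ z, 0 ≤ B z z) (u w : Z) :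
    -B u w ≤ √(B u u) * √(B w w) := by
  have h := LinearMap.BilinForm.apply_sq_le_of_symm B hpos (isSymm_iff.1 hB) u w
  rw [← Real.sqrt_mul (hpos u)]
  exact (neg_le_abs _).trans (Real.abs_le_sqrt h)

/-- If `B u (u - w) ≤ 0` then `B (u - w) (u - w) + B u u ≤ B w w`. -/
lemma apply_sub_add_apply_le (hB : B.IsSymm) {u w : Z} (h : B u (u - w) ≤ 0) :
    B (u - w) (u - w) + B u u ≤ B w w := by
  have hs := hB.eq u w
  simp only [map_sub, LinearMap.sub_apply] at *
  linarith

/-- The last step of a proximal-point type sequence has length `O(1 / √k)`. -/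
lemma mul_apply_step_le (hB : B.IsSymm) (hpos : ∀ z, 0 ≤ B z z) {z : ℕ → Z} {zstar : Z}
    (hfejer : ∀ k, B (z (k + 1) - zstar) (z (k + 1) - z k) ≤ 0)
    (hmono : ∀ k, B (z (k + 2) - z (k + 1)) (z (k + 2) - z (k + 1) - (z (k + 1) - z k)) ≤ 0)
    (k : ℕ) :
    k * B (z (k + 1) - z k) (z (k + 1) - z k) + B (z k - zstar) (z k - zstar) ≤
      B (z 0 - zstar) (z 0 - zstar) := by
  induction k with
  | zero => simp
  | succ k ih =>
    have h1 : B (z (k + 1) - z k) (z (k + 1) - z k) + B (z (k + 1) - zstar) (z (k + 1) - zstar) ≤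
        B (z k - zstar) (z k - zstar) := by
      have := apply_sub_add_apply_le hB (u := z (k + 1) - zstar) (w := z k - zstar)
      simp only [sub_sub_sub_cancel_right] at this
      exact this (hfejer k)
    have h2 := apply_sub_add_apply_le hB (hmono k)
    have h3 := hpos (z (k + 2) - z (k + 1) - (z (k + 1) - z k))
    have h4 : ((k : ℝ) + 1) * B (z (k + 2) - z (k + 1)) (z (k + 2) - z (k + 1)) ≤
        (k + 1) * B (z (k + 1) - z k) (z (k + 1) - z k) := by
      gcongr; linarith
    push_cast
    linarith

lemma neg_apply_step_le (hB : B.IsSymm) (hpos : ∀ z, 0 ≤ B z z) {z : ℕ → Z} {zstar : Z}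
    (hfejer : ∀ k, B (z (k + 1) - zstar) (z (k + 1) - z k) ≤ 0)
    (hmono : ∀ k, B (z (k + 2) - z (k + 1)) (z (k + 2) - z (k + 1) - (z (k + 1) - z k)) ≤ 0)
    (w : Z) {k : ℕ} (hk : 1 ≤ k) :
    -B (z (k + 1) - zstar + w) (z (k + 1) - z k) ≤
      (1 / √k) * (B (z 0 - zstar) (z 0 - zstar) + √(B w w) * √(B (z 0 - zstar) (z 0 - zstar))) := by
  set V := B (z 0 - zstar) (z 0 - zstar)
  have hk0 : (0 : ℝ) < k := by exact_mod_cast hk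
  have hV : 0 ≤ V := hpos _
  have h1 := mul_apply_step_le hB hpos hfejer hmono k
  have h2 := mul_apply_step_le hB hpos hfejer hmono (k + 1)
  have hstep : √(B (z (k + 1) - z k) (z (k + 1) - z k)) ≤ (1 / √k) * √V := by
    rw [one_div_mul_eq_div, ← Real.sqrt_div hV]
    apply Real.sqrt_le_sqrt
    rw [le_div_iff₀ hk0]
    linarith [hpos (z k - zstar)]
  have hdist : √(B (z (k + 1) - zstar) (z (k + 1) - zstar)) ≤ √V := by
    apply Real.sqrt_le_sqrt
    have := mul_nonneg (Nat.cast_nonneg (α := ℝ) (k + 1)) (hpos (z (k + 1 + 1) - z (k + 1)))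
    linarith
  calc -B (z (k + 1) - zstar + w) (z (k + 1) - z k)
      = -B (z (k + 1) - zstar) (z (k + 1) - z k) + -B w (z (k + 1) - z k) := by
        rw [map_add, LinearMap.add_apply, neg_add]
    _ ≤ √V * ((1 / √k) * √V) + √(B w w) * ((1 / √k) * √V) := by
        refine add_le_add ((neg_apply_le_sqrt_mul_sqrt hB hpos _ _).trans ?_)
          ((neg_apply_le_sqrt_mul_sqrt hB hpos _ _).trans ?_) <;> gcongr
    _ = (1 / √k) * (V + √(B w w) * √V) := by
        nth_rw 4 [← Real.mul_self_sqrt hV]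
        ring

end LinearMap.BilinForm

/-- The standard inner product on tuples of vectors, as a bilinear form. -/
noncomputable def tupleInner (ι E : Type*) [Fintype ι] [NormedAddCommGroup E]
    [InnerProductSpace ℝ E] : LinearMap.BilinForm ℝ (ι → E) :=
  ∑ i, (innerₗ E).compl₁₂ (LinearMap.proj i) (LinearMap.proj i)

/-- A scalar matrix acting on tuples of vectors. -/
def Matrix.tupleLin {ι : Type*} (E : Type*) [Fintype ι] [AddCommGroup E] [Module ℝ E]
    (A : Matrix ι ι ℝ) : (ι → E) →ₗ[ℝ] (ι → E) :=
  LinearMap.pi fun i => ∑ j, A i j • LinearMap.proj j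

section tuple

variable {ι E : Type*} [Fintype ι] [NormedAddCommGroup E] [InnerProductSpace ℝ E]

lemma tupleInner_apply (u w : ι → E) : tupleInner ι E u w = ∑ i, ⟪u i, w i⟫ := by
  simp [tupleInner, LinearMap.sum_apply]

lemma Matrix.tupleLin_apply (A : Matrix ι ι ℝ) (u : ι → E) (i : ι) :
    A.tupleLin E u i = ∑ j, A i j • u j := by
  simp [Matrix.tupleLin]

lemma tupleInner_comm (u w : ι → E) : tupleInner ι E u w = tupleInner ι E w u := by
  simp only [tupleInner_apply, real_inner_comm]

lemma tupleInner_tupleLin {A : Matrix ι ι ℝ} (hA : A.IsSymm) (u w : ι → E) :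
    tupleInner ι E u (A.tupleLin E w) = tupleInner ι E (A.tupleLin E u) w := by
  simp only [tupleInner_apply, Matrix.tupleLin_apply, inner_sum, sum_inner,
    real_inner_smul_left, real_inner_smul_right]
  rw [Finset.sum_comm]
  simp only [hA.apply]

lemma Matrix.tupleLin_tupleLin (A C : Matrix ι ι ℝ) (u : ι → E) :
    A.tupleLin E (C.tupleLin E u) = (A * C).tupleLin E u := by
  ext i
  simp only [Matrix.tupleLin_apply, Matrix.mul_apply, Finset.smul_sum, Finset.sum_smul, smul_smul]
  exact Finset.sum_comm

lemma eq_zero_of_tupleInner_self {u : ι → E} (h : tupleInner ι E u u = 0) : u = 0 := by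
  rw [tupleInner_apply, Finset.sum_eq_zero_iff_of_nonneg fun i _ => real_inner_self_nonneg] at h
  ext1 i
  exact inner_self_eq_zero.1 (h i (Finset.mem_univ i))

end tuple

/-- The weighted form `⟪u.1, G w.1⟫ + c * ⟪u.2, w.2⟫` on pairs of tuples. -/
noncomputable def pairForm {ι E : Type*} [Fintype ι] [NormedAddCommGroup E] [InnerProductSpace ℝ E]
    (G : (ι → E) →ₗ[ℝ] (ι → E)) (c : ℝ) : LinearMap.BilinForm ℝ ((ι → E) × (ι → E)) :=
  (tupleInner ι E).compl₁₂ (LinearMap.fst ℝ _ _) (G ∘ₗ LinearMap.fst ℝ _ _) +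
    c • (tupleInner ι E).compl₁₂ (LinearMap.snd ℝ _ _) (LinearMap.snd ℝ _ _)

lemma pairForm_apply {ι E : Type*} [Fintype ι] [NormedAddCommGroup E] [InnerProductSpace ℝ E]
    (G : (ι → E) →ₗ[ℝ] (ι → E)) (c : ℝ) (u w : (ι → E) × (ι → E)) :
    pairForm G c u w = tupleInner ι E u.1 (G w.1) + c * tupleInner ι E u.2 w.2 := by
  simp [pairForm]

/-- The change of a primal-dual pair under a step `G (y₁ - y₀) = r + S v₁`,
`v₁ - v₀ = -ρ S y₁`, measured against a test pair, only involves `r`. -/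
lemma pairForm_step {ι E : Type*} [Fintype ι] [NormedAddCommGroup E] [InnerProductSpace ℝ E]
    {G S : (ι → E) →ₗ[ℝ] (ι → E)} {ρ : ℝ} (hρ : ρ ≠ 0)
    (hS : ∀ u w, tupleInner ι E u (S w) = tupleInner ι E (S u) w)
    {a b e g r : ι → E} (hG : G e = r + S b) (hg : g = -(ρ • S a)) :
    pairForm G ρ⁻¹ (a, b) (e, g) = tupleInner ι E a r := by
  rw [pairForm_apply, hG, hg]
  simp only [map_add, map_neg, map_smul, LinearMap.neg_apply, LinearMap.smul_apply, smul_eq_mul,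
    hS a b, tupleInner_comm b]
  field_simp
  ring

/-- CONTEXT: economic dispatch via dual consensus; E = ℝ^p, variables in Eⁿ. -/
theorem stmt_8
    {n p : ℕ} (hn : 1 ≤ n) (hp : 1 ≤ p)
    (L M : Matrix (Fin n) (Fin n) ℝ)
    (hLsymm : L.IsSymm)
    (hLpsd : ∀ c : Fin n → ℝ, 0 ≤ ∑ i, ∑ j, c i * L i j * c j)
    (hLrow : ∀ i : Fin n, ∑ j, L i j = 0)
    (hMsymm : M.IsSymm)
    (hMpsd : ∀ c : Fin n → ℝ, 0 ≤ ∑ i, ∑ j, c i * M i j * c j)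
    (hMM : M * M = L)
    (W S : (Fin n → EuclideanSpace ℝ (Fin p)) → (Fin n → EuclideanSpace ℝ (Fin p)))
    (hW : ∀ (u : Fin n → EuclideanSpace ℝ (Fin p)) (i : Fin n), W u i = ∑ j, L i j • u j)
    (hS : ∀ (u : Fin n → EuclideanSpace ℝ (Fin p)) (i : Fin n), S u i = ∑ j, M i j • u j)
    {η ρ : ℝ} (hη : 0 < η) (hρ : 0 < ρ)
    (Ω : (Fin n → EuclideanSpace ℝ (Fin p)) → (Fin n → EuclideanSpace ℝ (Fin p)))
    (hΩdef : ∀ u : Fin n → EuclideanSpace ℝ (Fin p), Ω u = η • u - ρ • W u)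
    (hΩpd : ∀ u : Fin n → EuclideanSpace ℝ (Fin p), u ≠ 0 → 0 < ∑ i, ⟪u i, Ω u i⟫)
    (X : Fin n → Set (EuclideanSpace ℝ (Fin p)))
    (hXne : ∀ i, (X i).Nonempty) (hXcl : ∀ i, IsClosed (X i)) (hXconv : ∀ i, Convex ℝ (X i))
    (f : Fin n → EuclideanSpace ℝ (Fin p) → ℝ)
    (hfconv : ∀ i, ConvexOn ℝ Set.univ (f i))
    (d : Fin n → EuclideanSpace ℝ (Fin p))
    (x y v : ℕ → Fin n → EuclideanSpace ℝ (Fin p))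
    (hxX : ∀ (k : ℕ) (i : Fin n), x (k+1) i ∈ X i)
    (hstep : ∀ (k : ℕ) (i : Fin n), ∀ ξ ∈ X i,
      f i (x (k+1) i)
          + (η/2) * ‖y k i + η⁻¹ • (x (k+1) i - d i + S (v k) i - ρ • W (y k) i)‖^2
        ≤ f i ξ + (η/2) * ‖y k i + η⁻¹ • (ξ - d i + S (v k) i - ρ • W (y k) i)‖^2)
    (hy : ∀ k : ℕ, y (k+1) = y k + η⁻¹ • (x (k+1) - d + S (v k) - ρ • W (y k)))
    (hv : ∀ k : ℕ, v (k+1) = v k - ρ • S (y (k+1)))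
    (xstar : Fin n → EuclideanSpace ℝ (Fin p)) (δstar : EuclideanSpace ℝ (Fin p))
    (hxstarX : ∀ i, xstar i ∈ X i)
    (hbal : ∑ i, (xstar i - d i) = 0)
    (ystar : Fin n → EuclideanSpace ℝ (Fin p)) (hystar : ystar = fun _ => δstar)
    (hsaddle : ∀ x' : Fin n → EuclideanSpace ℝ (Fin p), (∀ i, x' i ∈ X i) →
      (∑ i, f i (xstar i)) - ∑ i, ⟪ystar i, x' i - xstar i⟫ ≤ ∑ i, f i (x' i))
    (vstar : Fin n → EuclideanSpace ℝ (Fin p)) (hvstar : S vstar = d - xstar)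
    (V₀ : ℝ)
    (hV₀ : V₀ = (∑ i, ⟪(y 0 - ystar) i, Ω (y 0 - ystar) i⟫) + (1/ρ) * ∑ i, ‖v 0 i - vstar i‖^2)
    :
    ∀ k : ℕ, 1 ≤ k →
      (∑ i, f i (x (k+1) i)) - (∑ i, f i (xstar i)) ≤
        (1 / Real.sqrt (k : ℝ)) *
          (V₀ + Real.sqrt (∑ i, ⟪ystar i, Ω ystar i⟫) * Real.sqrt V₀) := by
  obtain rfl : W = L.tupleLin _ := funext fun u => funext fun i => by
    rw [hW, Matrix.tupleLin_apply]
  obtain rfl : S = M.tupleLin _ := funext fun u => funext fun i => by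
    rw [hS, Matrix.tupleLin_apply]
  set S := M.tupleLin (EuclideanSpace ℝ (Fin p))
  set W := L.tupleLin (EuclideanSpace ℝ (Fin p))
  have hSS (u) : S (S u) = W u := by simp only [S, W, Matrix.tupleLin_tupleLin, hMM]
  have hSsymm (u w) : tupleInner _ _ u (S w) = tupleInner _ _ (S u) w :=
    tupleInner_tupleLin hMsymm u w
  have hWsymm (u w) : tupleInner _ _ u (W w) = tupleInner _ _ (W u) w :=
    tupleInner_tupleLin hLsymm u w
  set G : (Fin n → EuclideanSpace ℝ (Fin p)) →ₗ[ℝ] (Fin n → EuclideanSpace ℝ (Fin p)) :=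
    η • LinearMap.id - ρ • W with hG
  obtain rfl : Ω = G := funext fun u => by simp [hΩdef, hG]
  set B := pairForm G ρ⁻¹ with hBdef
  have hB : B.IsSymm := ⟨fun u w => by
    simp only [hBdef, pairForm_apply, hG, LinearMap.sub_apply, LinearMap.smul_apply,
      LinearMap.id_apply, map_sub, map_smul, hWsymm, tupleInner_comm u.2 w.2,
      tupleInner_comm u.1 w.1, tupleInner_comm (W u.1) w.1]⟩
  have hpos (u) : 0 ≤ B u u := by
    simp only [hBdef, pairForm_apply]
    refine add_nonneg ?_ (mul_nonneg (inv_nonneg.2 hρ.le) ?_)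
    · by_cases h : u.1 = 0
      · simp [h]
      · exact (tupleInner_apply u.1 (G u.1)).symm ▸ (hΩpd _ h).le
    · exact (tupleInner_apply u.2 u.2).symm ▸ Finset.sum_nonneg fun i _ => real_inner_self_nonneg
  have hSstar : S ystar = 0 := by
    apply eq_zero_of_tupleInner_self
    rw [← hSsymm, hSS]
    have : W ystar = 0 := by
      ext1 i
      rw [hystar, Matrix.tupleLin_apply, ← Finset.sum_smul, hLrow, zero_smul, Pi.zero_apply]
    rw [this, map_zero]
  have hGstep (k) : G (y (k + 1) - y k) = x (k + 1) - d + S (v (k + 1)) := by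
    have h1 : η • (y (k + 1) - y k) = x (k + 1) - d + S (v k) - ρ • W (y k) := by
      rw [hy k, add_sub_cancel_left, smul_inv_smul₀ hη.ne']
    have h2 : S (v (k + 1)) = S (v k) - ρ • W (y (k + 1)) := by
      rw [hv, map_sub, map_smul, hSS]
    rw [hG, LinearMap.sub_apply, LinearMap.smul_apply, LinearMap.smul_apply, LinearMap.id_apply, h1,
      h2, map_sub]
    module
  have hvstep (k) : v (k + 1) - v k = -(ρ • S (y (k + 1))) := by rw [hv]; abel
  have hopt (k) (x' : Fin n → EuclideanSpace ℝ (Fin p)) (hx' : ∀ i, x' i ∈ X i) :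
      ∑ i, f i (x (k + 1) i) ≤
        ∑ i, f i (x' i) + tupleInner _ _ (y (k + 1)) (x' - x (k + 1)) := by
    rw [tupleInner_apply, ← Finset.sum_add_distrib]
    refine Finset.sum_le_sum fun i _ => ?_
    have hpt (ξ : EuclideanSpace ℝ (Fin p)) :
        y k i + η⁻¹ • (ξ - d i + S (v k) i - ρ • W (y k) i) =
          (y k i + η⁻¹ • (S (v k) i - d i - ρ • W (y k) i)) + η⁻¹ • ξ := by module
    have hyi : y (k + 1) i =
        (y k i + η⁻¹ • (S (v k) i - d i - ρ • W (y k) i)) + η⁻¹ • x (k + 1) i := by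
      rw [← hpt, hy k]; rfl
    have hmin := hstep k i
    simp only [hpt] at hmin
    rw [hyi]
    exact le_add_inner_of_forall_add_norm_sq_le (hfconv i) (hXconv i) hη (hxX k i) hmin (hx' i)
  set z : ℕ → (Fin n → EuclideanSpace ℝ (Fin p)) × (Fin n → EuclideanSpace ℝ (Fin p)) :=
    fun k => (y k, v k) with hz
  have hGstar (k) : G (y (k + 1) - y k) = (x (k + 1) - xstar) + S (v (k + 1) - vstar) := by
    rw [hGstep, map_sub, hvstar]; abel
  have hfejer (k) : B (z (k + 1) - (ystar, vstar)) (z (k + 1) - z k) ≤ 0 := by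
    have h : B (z (k + 1) - (ystar, vstar)) (z (k + 1) - z k) =
        tupleInner _ _ (y (k + 1) - ystar) (x (k + 1) - xstar) :=
      pairForm_step hρ.ne' hSsymm (hGstar k) (by rw [map_sub, hSstar, sub_zero, hvstep])
    have h1 := hopt k xstar hxstarX
    have h2 := hsaddle (x (k + 1)) (hxX k)
    have h3 := tupleInner_apply ystar (x (k + 1) - xstar)
    simp only [Pi.sub_apply] at h3
    rw [← h3] at h2
    rw [h]
    simp only [map_sub, LinearMap.sub_apply] at h1 h2 ⊢
    linarith
  have hmono (k) : B (z (k + 2) - z (k + 1)) (z (k + 2) - z (k + 1) - (z (k + 1) - z k)) ≤ 0 := by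
    have h : B (z (k + 2) - z (k + 1)) (z (k + 2) - z (k + 1) - (z (k + 1) - z k)) =
        tupleInner _ _ (y (k + 2) - y (k + 1)) (x (k + 2) - x (k + 1)) := by
      refine pairForm_step hρ.ne' hSsymm ?_ ?_
      · change G (y (k + 2) - y (k + 1) - (y (k + 1) - y k)) =
          x (k + 2) - x (k + 1) + S (v (k + 2) - v (k + 1))
        rw [map_sub, hGstep, hGstep, map_sub]
        abel
      · change v (k + 2) - v (k + 1) - (v (k + 1) - v k) = -(ρ • S (y (k + 2) - y (k + 1)))
        rw [hvstep, hvstep, map_sub]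
        module
    have h1 := hopt k (x (k + 2)) (hxX (k + 1))
    have h2 := hopt (k + 1) (x (k + 1)) (hxX k)
    rw [h]
    simp only [map_sub, LinearMap.sub_apply] at h1 h2 ⊢
    linarith
  intro k hk
  have hbound := LinearMap.BilinForm.neg_apply_step_le hB hpos hfejer hmono (ystar, 0) hk
  have hcost : B (z (k + 1) - (ystar, vstar) + (ystar, 0)) (z (k + 1) - z k) =
      tupleInner _ _ (y (k + 1)) (x (k + 1) - xstar) := by
    have hpair : z (k + 1) - (ystar, vstar) + (ystar, 0) = (y (k + 1), v (k + 1) - vstar) := by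
      simp [hz]
    rw [hpair]
    exact pairForm_step hρ.ne' hSsymm (hGstar k) (hvstep k)
  have hV : B (z 0 - (ystar, vstar)) (z 0 - (ystar, vstar)) = V₀ := by
    simp only [hBdef, hz, pairForm_apply, tupleInner_apply, hV₀, Prod.fst_sub, Prod.snd_sub,
      Pi.sub_apply, real_inner_self_eq_norm_sq, one_div]
  have hystarnorm : B (ystar, 0) (ystar, 0) = ∑ i, ⟪ystar i, G ystar i⟫ := by
    simp [hBdef, pairForm_apply, tupleInner_apply]
  rw [hcost, hV, hystarnorm] at hbound
  refine le_trans ?_ hbound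
  have h1 := hopt k xstar hxstarX
  simp only [map_sub] at h1 ⊢
  linarith
end

section
/- For every k ≥ 1 the global cost of the economic dispatch iterates satisfies the non-ergodic lower bound f(x_{k+1}) − f(x*) ≥ −(1/√k)·‖y*‖_Ω·√V_0. -/
open scoped RealInnerProductSpace

/-- First-order optimality condition for a proximal step: if `a` minimizes
`g ξ + (η / 2) * ‖q + η⁻¹ • (ξ - a)‖ ^ 2` over a convex set, then `-q` is a subgradient of `g`
at `a` relative to that set. -/
theorem ConvexOn.sub_inner_le_of_forall_prox_le {E : Type*} [NormedAddCommGroup E]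
    [InnerProductSpace ℝ E] {g : E → ℝ} {C : Set E} (hg : ConvexOn ℝ C g) {η : ℝ} (hη : 0 < η)
    {a q : E} (ha : a ∈ C)
    (hmin : ∀ ξ ∈ C, g a + (η / 2) * ‖q‖ ^ 2 ≤ g ξ + (η / 2) * ‖q + η⁻¹ • (ξ - a)‖ ^ 2)
    {ξ : E} (hξ : ξ ∈ C) : g a - ⟪q, ξ - a⟫ ≤ g ξ := by
  have key : ∀ t : ℝ, 0 < t → t ≤ 1 →
      0 ≤ g ξ - g a + ⟪q, ξ - a⟫ + t * (‖ξ - a‖ ^ 2 / (2 * η)) := by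
    intro t ht ht1
    have hm := hmin _ (hg.1 ha hξ (sub_nonneg.2 ht1) ht.le (by ring))
    have hc := hg.2 ha hξ (sub_nonneg.2 ht1) ht.le (by ring)
    rw [show (1 - t) • a + t • ξ - a = t • (ξ - a) by module, norm_add_sq_real, smul_smul,
      real_inner_smul_right, norm_smul, Real.norm_eq_abs, mul_pow, sq_abs] at hm
    simp only [smul_eq_mul] at hc
    have h : 0 ≤ t * (g ξ - g a + ⟪q, ξ - a⟫ + t * (‖ξ - a‖ ^ 2 / (2 * η))) := by
      have e : η / 2 * (‖q‖ ^ 2 + 2 * (η⁻¹ * t * ⟪q, ξ - a⟫) + (η⁻¹ * t) ^ 2 * ‖ξ - a‖ ^ 2)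
          = η / 2 * ‖q‖ ^ 2 + t * ⟪q, ξ - a⟫ + t * (t * (‖ξ - a‖ ^ 2 / (2 * η))) := by
        field_simp
      linarith
    exact nonneg_of_mul_nonneg_right h ht
  have hB : 0 ≤ ‖ξ - a‖ ^ 2 / (2 * η) := by positivity
  have hlim : Filter.Tendsto (fun t : ℝ => g ξ - g a + ⟪q, ξ - a⟫ + t * (‖ξ - a‖ ^ 2 / (2 * η)))
      (nhdsWithin 0 (Set.Ioi 0)) (nhds (g ξ - g a + ⟪q, ξ - a⟫ + 0 * (‖ξ - a‖ ^ 2 / (2 * η)))) :=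
    (Continuous.tendsto (by fun_prop) 0).mono_left nhdsWithin_le_nhds
  have h0 := ge_of_tendsto hlim (by
    filter_upwards [Ioc_mem_nhdsGT (zero_lt_one' ℝ)] with t ht using key t ht.1 ht.2)
  linarith

section InnerProductSpace

variable {H : Type*} [NormedAddCommGroup H] [InnerProductSpace ℝ H]

/-- Polarization for a symmetric operator. -/
theorem LinearMap.IsSymmetric.two_mul_inner_apply_sub {T : H →ₗ[ℝ] H} (hT : T.IsSymmetric)
    (a b : H) : 2 * ⟪a, T (a - b)⟫ = ⟪a, T a⟫ + ⟪a - b, T (a - b)⟫ - ⟪b, T b⟫ := by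
  have h : ⟪b, T a⟫ = ⟪a, T b⟫ := by rw [← hT, real_inner_comm]
  simp only [map_sub, inner_sub_left, inner_sub_right]
  linarith

/-- Cauchy-Schwarz inequality for a positive semidefinite symmetric operator. -/
theorem LinearMap.IsSymmetric.inner_apply_le_sqrt_mul_sqrt {T : H →ₗ[ℝ] H} (hT : T.IsSymmetric)
    (hpos : ∀ u, 0 ≤ ⟪u, T u⟫) (a b : H) :
    ⟪a, T b⟫ ≤ √⟪a, T a⟫ * √⟪b, T b⟫ := by
  have h : ⟪b, T a⟫ = ⟪a, T b⟫ := by rw [← hT, real_inner_comm]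
  rw [← Real.sqrt_mul (hpos a)]
  apply Real.le_sqrt_of_sq_le
  have hd := discrim_le_zero (a := ⟪b, T b⟫) (b := 2 * ⟪a, T b⟫) (c := ⟪a, T a⟫) (fun t => by
    have := hpos (a + t • b)
    simp only [map_add, map_smul, inner_add_left, inner_add_right, real_inner_smul_left,
      real_inner_smul_right, h] at this
    linarith)
  rw [discrim] at hd
  linarith

/-- One step of the primal-dual recursion decreases the energy
`⟪a, Ω a⟫ + ρ⁻¹ * ‖b‖ ^ 2` by at least the energy of the increment. -/
theorem LinearMap.IsSymmetric.energy_add_le {Ω S : H →ₗ[ℝ] H} (hΩ : Ω.IsSymmetric)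
    (hS : S.IsSymmetric) {ρ : ℝ} (hρ : 0 < ρ) {a a' b b' r : H}
    (hprimal : Ω (a - a') = r + S b) (hdual : b = b' - ρ • S a) (hr : ⟪a, r⟫ ≤ 0) :
    ⟪a, Ω a⟫ + ρ⁻¹ * ‖b‖ ^ 2 + (⟪a - a', Ω (a - a')⟫ + ρ⁻¹ * ‖b - b'‖ ^ 2)
      ≤ ⟪a', Ω a'⟫ + ρ⁻¹ * ‖b'‖ ^ 2 := by
  have hpol := hΩ.two_mul_inner_apply_sub a a'
  have hb : 2 * ⟪b, b - b'⟫ = ‖b‖ ^ 2 + ‖b - b'‖ ^ 2 - ‖b'‖ ^ 2 := by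
    rw [norm_sub_sq_real, inner_sub_right, real_inner_self_eq_norm_sq]
    ring
  have hSb : ⟪a, S b⟫ = -(ρ⁻¹ * ⟪b, b - b'⟫) := by
    have e : b - b' = -(ρ • S a) := by rw [hdual]; abel
    rw [e, inner_neg_right, real_inner_smul_right, ← hS, real_inner_comm]
    field_simp
  rw [hprimal, inner_add_right, hSb, ← hprimal] at hpol
  have := congrArg (ρ⁻¹ * ·) hb
  linarith

/-- Sublinear decay of the last increment of the primal-dual recursion. -/
theorem LinearMap.IsSymmetric.mul_increment_le_energy {Ω S : H →ₗ[ℝ] H} (hΩ : Ω.IsSymmetric)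
    (hpos : ∀ u, 0 ≤ ⟪u, Ω u⟫) (hS : S.IsSymmetric) {ρ : ℝ} (hρ : 0 < ρ) {x y v : ℕ → H}
    {xs ys vs : H} (hSys : S ys = 0)
    (hprimal : ∀ k, Ω (y (k + 1) - y k) = x (k + 1) - xs + S (v (k + 1) - vs))
    (hdual : ∀ k, v (k + 1) = v k - ρ • S (y (k + 1)))
    (hmono : ∀ k, ⟪y (k + 1) - ys, x (k + 1) - xs⟫ ≤ 0)
    (hmono' : ∀ k, ⟪y (k + 2) - y (k + 1), x (k + 2) - x (k + 1)⟫ ≤ 0) (k : ℕ) :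
    (k + 1) * ⟪y (k + 1) - y k, Ω (y (k + 1) - y k)⟫
      ≤ ⟪y 0 - ys, Ω (y 0 - ys)⟫ + ρ⁻¹ * ‖v 0 - vs‖ ^ 2 := by
  set V : ℕ → ℝ := fun k => ⟪y k - ys, Ω (y k - ys)⟫ + ρ⁻¹ * ‖v k - vs‖ ^ 2
  set D : ℕ → ℝ := fun k =>
    ⟪y (k + 1) - y k, Ω (y (k + 1) - y k)⟫ + ρ⁻¹ * ‖v (k + 1) - v k‖ ^ 2 with hD
  have hVD : ∀ k, V (k + 1) + D k ≤ V k := by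
    intro k
    have := hΩ.energy_add_le hS hρ (a := y (k + 1) - ys) (a' := y k - ys) (b := v (k + 1) - vs)
      (b' := v k - vs) (r := x (k + 1) - xs) (by rw [sub_sub_sub_cancel_right, hprimal])
      (by rw [hdual, map_sub, hSys, sub_zero]; abel) (hmono k)
    simpa only [sub_sub_sub_cancel_right] using this
  have hDD : ∀ k, D (k + 1) ≤ D k := by
    intro k
    have := hΩ.energy_add_le hS hρ (a := y (k + 2) - y (k + 1)) (a' := y (k + 1) - y k)
      (b := v (k + 2) - v (k + 1)) (b' := v (k + 1) - v k) (r := x (k + 2) - x (k + 1))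
      (by
        rw [map_sub, hprimal (k + 1), hprimal k, add_sub_add_comm, ← map_sub,
          sub_sub_sub_cancel_right, sub_sub_sub_cancel_right])
      (by rw [hdual (k + 1), hdual k, map_sub, smul_sub]; abel) (hmono' k)
    have h1 := hpos (y (k + 2) - y (k + 1) - (y (k + 1) - y k))
    have h2 : 0 ≤ ρ⁻¹ * ‖v (k + 2) - v (k + 1) - (v (k + 1) - v k)‖ ^ 2 := by positivity
    simp only [hD]
    linarith
  have hsum : ∀ k : ℕ, V (k + 1) + (k + 1) * D k ≤ V 0 := by
    intro k
    induction k with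
    | zero => simpa using hVD 0
    | succ k ih =>
      have h1 := hVD (k + 1)
      have h2 := mul_le_mul_of_nonneg_left (hDD k) (by positivity : (0 : ℝ) ≤ (k : ℝ) + 1)
      push_cast
      linarith
  have hVk : 0 ≤ V (k + 1) := add_nonneg (hpos _) (by positivity)
  have hle : ⟪y (k + 1) - y k, Ω (y (k + 1) - y k)⟫ ≤ D k :=
    le_add_of_nonneg_right (by positivity)
  have := mul_le_mul_of_nonneg_left hle (by positivity : (0 : ℝ) ≤ (k : ℝ) + 1)
  linarith [hsum k]

end InnerProductSpace

namespace Matrix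

variable {ι E : Type*} [Fintype ι] [NormedAddCommGroup E] [InnerProductSpace ℝ E]

/-- The action `A ⊗ id` of a square matrix on tuples of vectors. -/
noncomputable def blockMap (A : Matrix ι ι ℝ) :
    PiLp 2 (fun _ : ι => E) →ₗ[ℝ] PiLp 2 (fun _ : ι => E) where
  toFun u := WithLp.toLp 2 fun i => ∑ j, A i j • u j
  map_add' u w := by ext i; simp [Finset.sum_add_distrib]
  map_smul' c u := by ext i; simp [Finset.smul_sum, smul_comm c]

@[simp]
theorem blockMap_apply (A : Matrix ι ι ℝ) (u : PiLp 2 (fun _ : ι => E)) (i : ι) :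
    A.blockMap u i = ∑ j, A i j • u j := rfl

theorem IsSymm.isSymmetric_blockMap {A : Matrix ι ι ℝ} (hA : A.IsSymm) :
    (A.blockMap : PiLp 2 (fun _ : ι => E) →ₗ[ℝ] _).IsSymmetric := by
  intro u w
  simp only [PiLp.inner_apply, blockMap_apply, sum_inner, inner_sum, real_inner_smul_left,
    real_inner_smul_right]
  rw [Finset.sum_comm]
  simp only [hA.apply]

theorem blockMap_mul_apply (A B : Matrix ι ι ℝ) (u : PiLp 2 (fun _ : ι => E)) :
    (A * B).blockMap u = A.blockMap (B.blockMap u) := by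
  ext1 i
  simp only [blockMap_apply, Matrix.mul_apply, Finset.sum_smul, Finset.smul_sum, smul_smul]
  exact Finset.sum_comm

theorem blockMap_const_eq_zero {A : Matrix ι ι ℝ} (hA : ∀ i, ∑ j, A i j = 0) (c : E) :
    A.blockMap (WithLp.toLp 2 fun _ => c) = 0 := by
  ext1 i
  simp [← Finset.sum_smul, hA]

end Matrix

/-- CONTEXT: economic dispatch via dual consensus; E = ℝ^p, variables in Eⁿ. -/
theorem stmt_9
    {n p : ℕ} (hn : 1 ≤ n) (hp : 1 ≤ p)
    (L M : Matrix (Fin n) (Fin n) ℝ)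
    (hLsymm : L.IsSymm)
    (hLpsd : ∀ c : Fin n → ℝ, 0 ≤ ∑ i, ∑ j, c i * L i j * c j)
    (hLrow : ∀ i : Fin n, ∑ j, L i j = 0)
    (hMsymm : M.IsSymm)
    (hMpsd : ∀ c : Fin n → ℝ, 0 ≤ ∑ i, ∑ j, c i * M i j * c j)
    (hMM : M * M = L)
    (W S : (Fin n → EuclideanSpace ℝ (Fin p)) → (Fin n → EuclideanSpace ℝ (Fin p)))
    (hW : ∀ (u : Fin n → EuclideanSpace ℝ (Fin p)) (i : Fin n), W u i = ∑ j, L i j • u j)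
    (hS : ∀ (u : Fin n → EuclideanSpace ℝ (Fin p)) (i : Fin n), S u i = ∑ j, M i j • u j)
    {η ρ : ℝ} (hη : 0 < η) (hρ : 0 < ρ)
    (Ω : (Fin n → EuclideanSpace ℝ (Fin p)) → (Fin n → EuclideanSpace ℝ (Fin p)))
    (hΩdef : ∀ u : Fin n → EuclideanSpace ℝ (Fin p), Ω u = η • u - ρ • W u)
    (hΩpd : ∀ u : Fin n → EuclideanSpace ℝ (Fin p), u ≠ 0 → 0 < ∑ i, ⟪u i, Ω u i⟫)
    (X : Fin n → Set (EuclideanSpace ℝ (Fin p)))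
    (hXne : ∀ i, (X i).Nonempty) (hXcl : ∀ i, IsClosed (X i)) (hXconv : ∀ i, Convex ℝ (X i))
    (f : Fin n → EuclideanSpace ℝ (Fin p) → ℝ)
    (hfconv : ∀ i, ConvexOn ℝ Set.univ (f i))
    (d : Fin n → EuclideanSpace ℝ (Fin p))
    (x y v : ℕ → Fin n → EuclideanSpace ℝ (Fin p))
    (hxX : ∀ (k : ℕ) (i : Fin n), x (k+1) i ∈ X i)
    (hstep : ∀ (k : ℕ) (i : Fin n), ∀ ξ ∈ X i,
      f i (x (k+1) i)
          + (η/2) * ‖y k i + η⁻¹ • (x (k+1) i - d i + S (v k) i - ρ • W (y k) i)‖^2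
        ≤ f i ξ + (η/2) * ‖y k i + η⁻¹ • (ξ - d i + S (v k) i - ρ • W (y k) i)‖^2)
    (hy : ∀ k : ℕ, y (k+1) = y k + η⁻¹ • (x (k+1) - d + S (v k) - ρ • W (y k)))
    (hv : ∀ k : ℕ, v (k+1) = v k - ρ • S (y (k+1)))
    (xstar : Fin n → EuclideanSpace ℝ (Fin p)) (δstar : EuclideanSpace ℝ (Fin p))
    (hxstarX : ∀ i, xstar i ∈ X i)
    (hbal : ∑ i, (xstar i - d i) = 0)
    (ystar : Fin n → EuclideanSpace ℝ (Fin p)) (hystar : ystar = fun _ => δstar)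
    (hsaddle : ∀ x' : Fin n → EuclideanSpace ℝ (Fin p), (∀ i, x' i ∈ X i) →
      (∑ i, f i (xstar i)) - ∑ i, ⟪ystar i, x' i - xstar i⟫ ≤ ∑ i, f i (x' i))
    (vstar : Fin n → EuclideanSpace ℝ (Fin p)) (hvstar : S vstar = d - xstar)
    (V₀ : ℝ)
    (hV₀ : V₀ = (∑ i, ⟪(y 0 - ystar) i, Ω (y 0 - ystar) i⟫) + (1/ρ) * ∑ i, ‖v 0 i - vstar i‖^2)
    :
    ∀ k : ℕ, 1 ≤ k →
      -(1 / Real.sqrt (k : ℝ)) * (Real.sqrt (∑ i, ⟪ystar i, Ω ystar i⟫) * Real.sqrt V₀) ≤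
        (∑ i, f i (x (k+1) i)) - (∑ i, f i (xstar i)) := by
  have hSH : ∀ u, WithLp.toLp 2 (S u) = M.blockMap (WithLp.toLp 2 u) := fun u => by
    ext1 i; simp [hS]
  have hWH : ∀ u, WithLp.toLp 2 (W u) = L.blockMap (WithLp.toLp 2 u) := fun u => by
    ext1 i; simp [hW]
  have hMsym := hMsymm.isSymmetric_blockMap (E := EuclideanSpace ℝ (Fin p))
  obtain ⟨T, hT⟩ : ∃ T : PiLp 2 (fun _ : Fin n => EuclideanSpace ℝ (Fin p)) →ₗ[ℝ]
      PiLp 2 (fun _ : Fin n => EuclideanSpace ℝ (Fin p)),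
      T = η • LinearMap.id - ρ • L.blockMap := ⟨η • LinearMap.id - ρ • L.blockMap, rfl⟩
  have hTapp : ∀ u, T u = η • u - ρ • L.blockMap u := fun u => by simp [hT]
  have hΩT : ∀ u w : Fin n → EuclideanSpace ℝ (Fin p),
      ∑ i, ⟪u i, Ω w i⟫ = ⟪WithLp.toLp 2 u, T (WithLp.toLp 2 w)⟫ := fun u w => by
    rw [hTapp, ← hWH, PiLp.inner_apply, hΩdef]
    rfl
  have hTsym : T.IsSymmetric := fun u w => by
    simp only [hTapp, inner_sub_left, inner_sub_right, real_inner_smul_left,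
      real_inner_smul_right, hLsymm.isSymmetric_blockMap u w]
  have hTpos : ∀ u, 0 ≤ ⟪u, T u⟫ := fun u => by
    rcases eq_or_ne u 0 with rfl | hu
    · simp
    · have h := hΩpd u.ofLp (fun h => hu (by ext1 i; exact congrFun h i))
      rw [hΩT] at h
      exact h.le
  have hSys : M.blockMap (WithLp.toLp 2 ystar) = 0 := by
    rw [← inner_self_eq_zero (𝕜 := ℝ), hMsym, ← Matrix.blockMap_mul_apply, hMM, hystar,
      Matrix.blockMap_const_eq_zero hLrow, inner_zero_right]
  have hdual : ∀ k, WithLp.toLp 2 (v (k + 1)) =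
      WithLp.toLp 2 (v k) - ρ • M.blockMap (WithLp.toLp 2 (y (k + 1))) := fun k => by
    rw [hv, ← hSH]; rfl
  have hprimal : ∀ k, T (WithLp.toLp 2 (y (k + 1)) - WithLp.toLp 2 (y k)) =
      WithLp.toLp 2 (x (k + 1)) - WithLp.toLp 2 xstar
        + M.blockMap (WithLp.toLp 2 (v (k + 1)) - WithLp.toLp 2 vstar) := fun k => by
    have h1 : η • (WithLp.toLp 2 (y (k + 1)) - WithLp.toLp 2 (y k)) =
        WithLp.toLp 2 (x (k + 1)) - WithLp.toLp 2 d + M.blockMap (WithLp.toLp 2 (v k))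
          - ρ • L.blockMap (WithLp.toLp 2 (y k)) := by
      rw [← hSH, ← hWH, hy k, WithLp.toLp_add, add_sub_cancel_left, WithLp.toLp_smul,
        smul_inv_smul₀ hη.ne']
      rfl
    have h2 : M.blockMap (WithLp.toLp 2 vstar) = WithLp.toLp 2 d - WithLp.toLp 2 xstar := by
      rw [← hSH, hvstar]; rfl
    rw [hTapp, h1, map_sub, map_sub, h2, hdual, map_sub, map_smul, ← Matrix.blockMap_mul_apply,
      hMM, smul_sub]
    abel
  have hsub : ∀ k i, ∀ ξ ∈ X i, f i (x (k + 1) i) - ⟪y (k + 1) i, ξ - x (k + 1) i⟫ ≤ f i ξ := by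
    intro k i ξ hξ
    have hyi : y (k + 1) i =
        y k i + η⁻¹ • (x (k + 1) i - d i + S (v k) i - ρ • W (y k) i) := by
      rw [hy k]; rfl
    refine ((hfconv i).subset (Set.subset_univ _) (hXconv i)).sub_inner_le_of_forall_prox_le hη
      (hxX k i) (fun ζ hζ => ?_) hξ
    have h := hstep k i ζ hζ
    have e : y (k + 1) i + η⁻¹ • (ζ - x (k + 1) i) =
        y k i + η⁻¹ • (ζ - d i + S (v k) i - ρ • W (y k) i) := by
      rw [hyi]
      module
    rwa [← hyi, ← e] at h
  have hsub' : ∀ k, ∀ x' : Fin n → EuclideanSpace ℝ (Fin p), (∀ i, x' i ∈ X i) →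
      ∑ i, f i (x (k + 1) i) - ⟪WithLp.toLp 2 (y (k + 1)),
        WithLp.toLp 2 x' - WithLp.toLp 2 (x (k + 1))⟫ ≤ ∑ i, f i (x' i) := by
    intro k x' hx'
    rw [PiLp.inner_apply, ← Finset.sum_sub_distrib]
    exact Finset.sum_le_sum fun i _ => hsub k i (x' i) (hx' i)
  have hsaddle' : ∀ k, ∑ i, f i (xstar i) - ⟪WithLp.toLp 2 ystar,
      WithLp.toLp 2 (x (k + 1)) - WithLp.toLp 2 xstar⟫ ≤ ∑ i, f i (x (k + 1) i) := by
    intro k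
    rw [PiLp.inner_apply]
    exact hsaddle _ (hxX k)
  have hmono : ∀ k, ⟪WithLp.toLp 2 (y (k + 1)) - WithLp.toLp 2 ystar,
      WithLp.toLp 2 (x (k + 1)) - WithLp.toLp 2 xstar⟫ ≤ 0 := fun k => by
    have h1 := hsub' k xstar hxstarX
    have h2 := hsaddle' k
    simp only [inner_sub_left, inner_sub_right] at h1 h2 ⊢
    linarith
  have hmono' : ∀ k, ⟪WithLp.toLp 2 (y (k + 2)) - WithLp.toLp 2 (y (k + 1)),
      WithLp.toLp 2 (x (k + 2)) - WithLp.toLp 2 (x (k + 1))⟫ ≤ 0 := fun k => by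
    have h1 := hsub' k (x (k + 2)) (hxX (k + 1))
    have h2 := hsub' (k + 1) (x (k + 1)) (hxX k)
    simp only [add_assoc, one_add_one_eq_two, inner_sub_left, inner_sub_right] at h1 h2 ⊢
    linarith
  have hV₀' : V₀ = ⟪WithLp.toLp 2 (y 0) - WithLp.toLp 2 ystar,
      T (WithLp.toLp 2 (y 0) - WithLp.toLp 2 ystar)⟫
        + ρ⁻¹ * ‖WithLp.toLp 2 (v 0) - WithLp.toLp 2 vstar‖ ^ 2 := by
    rw [hV₀, hΩT, PiLp.norm_sq_eq_of_L2, one_div]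
    rfl
  intro k hk
  have hk0 : (0 : ℝ) < k := by exact_mod_cast hk
  have hdecay := hTsym.mul_increment_le_energy hTpos hMsym hρ
    (x := fun k => WithLp.toLp 2 (x k)) (y := fun k => WithLp.toLp 2 (y k))
    (v := fun k => WithLp.toLp 2 (v k)) hSys hprimal hdual hmono hmono' k
  rw [← hV₀'] at hdecay
  set Δ := WithLp.toLp 2 (y (k + 1)) - WithLp.toLp 2 (y k)
  have hΔ : √⟪Δ, T Δ⟫ ≤ √V₀ / √k := by
    rw [← Real.sqrt_div' _ hk0.le]
    apply Real.sqrt_le_sqrt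
    rw [le_div_iff₀ hk0]
    linarith [hTpos Δ]
  have hxk : ⟪WithLp.toLp 2 ystar, WithLp.toLp 2 (x (k + 1)) - WithLp.toLp 2 xstar⟫ =
      ⟪WithLp.toLp 2 ystar, T Δ⟫ := by
    rw [hprimal, inner_add_right, ← hMsym, hSys, inner_zero_left, add_zero]
  have hcs := (hTsym.inner_apply_le_sqrt_mul_sqrt hTpos (WithLp.toLp 2 ystar) Δ).trans
    (mul_le_mul_of_nonneg_left hΔ (Real.sqrt_nonneg _))
  have hlow := hsaddle' k
  rw [hxk] at hlow
  rw [hΩT]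
  calc _ = -(√⟪WithLp.toLp 2 ystar, T (WithLp.toLp 2 ystar)⟫ * (√V₀ / √k)) := by ring
    _ ≤ _ := by linarith
end

section
/- For every k ≥ 0, the negative of the dual iterate −y_{k+1} is a subgradient of f + indicator of X at x_{k+1}: for all x ∈ X, f(x) + ⟪y_{k+1}, x⟫ ≥ f(x_{k+1}) + ⟪y_{k+1}, x_{k+1}⟫. -/
open scoped RealInnerProductSpace

/-- If `t ↦ D + t * C` is nonnegative on `(0, 1]` and `C` is nonnegative, then so is `D`. -/
theorem nonneg_of_forall_add_mul_nonneg {C D : ℝ} (hC : 0 ≤ C)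
    (h : ∀ t : ℝ, 0 < t → t ≤ 1 → 0 ≤ D + t * C) : 0 ≤ D := by
  by_contra! hD
  have hpos : 0 < C - D := by linarith
  have key := h (-D / (C - D)) (div_pos (by linarith) hpos) ((div_le_one hpos).2 (by linarith))
  have heq : D + -D / (C - D) * C = -(D ^ 2 / (C - D)) := by
    field_simp
    ring
  have : 0 < D ^ 2 / (C - D) := div_pos (by nlinarith) hpos
  linarith

/-- First-order optimality for a convex function plus a quadratic: the negative of the gradient
of the quadratic at the minimizer `a` is a subgradient of `g` on `s` at `a`. -/
theorem ConvexOn.add_inner_le_of_isMin_add_sq {H : Type*} [NormedAddCommGroup H]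
    [InnerProductSpace ℝ H] {s : Set H} {g : H → ℝ} (hg : ConvexOn ℝ s g) {η : ℝ} (hη : 0 < η)
    {a w : H} (ha : a ∈ s)
    (hmin : ∀ ξ ∈ s, g a + η / 2 * ‖w‖ ^ 2 ≤ g ξ + η / 2 * ‖w + η⁻¹ • (ξ - a)‖ ^ 2)
    {ξ : H} (hξ : ξ ∈ s) : g a + ⟪w, a⟫ ≤ g ξ + ⟪w, ξ⟫ := by
  suffices 0 ≤ g ξ - g a + ⟪w, ξ - a⟫ by
    rw [inner_sub_right] at this
    linarith
  refine nonneg_of_forall_add_mul_nonneg (C := ‖ξ - a‖ ^ 2 / (2 * η)) (by positivity)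
    fun t ht ht1 ↦ ?_
  have hz := hmin _ (hg.1 ha hξ (sub_nonneg.2 ht1) ht.le (by ring))
  have hgz := hg.2 ha hξ (sub_nonneg.2 ht1) ht.le (by ring)
  have hdiff : (1 - t) • a + t • ξ - a = t • (ξ - a) := by module
  rw [hdiff, smul_smul, norm_add_sq_real, inner_smul_right, norm_smul, mul_pow, Real.norm_eq_abs,
    sq_abs] at hz
  simp only [smul_eq_mul] at hgz
  have hquad : η / 2 * (‖w‖ ^ 2 + 2 * (η⁻¹ * t * ⟪w, ξ - a⟫) + (η⁻¹ * t) ^ 2 * ‖ξ - a‖ ^ 2) =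
      η / 2 * ‖w‖ ^ 2 + t * ⟪w, ξ - a⟫ + t * (t * (‖ξ - a‖ ^ 2 / (2 * η))) := by
    field_simp
  rw [hquad] at hz
  refine nonneg_of_mul_nonneg_right ?_ ht
  linarith

/-- CONTEXT: economic dispatch via dual consensus; E = ℝ^p, variables in Eⁿ. -/
theorem stmt_11
    {n p : ℕ} (hn : 1 ≤ n) (hp : 1 ≤ p)
    (L M : Matrix (Fin n) (Fin n) ℝ)
    (hLsymm : L.IsSymm)
    (hLpsd : ∀ c : Fin n → ℝ, 0 ≤ ∑ i, ∑ j, c i * L i j * c j)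
    (hLrow : ∀ i : Fin n, ∑ j, L i j = 0)
    (hMsymm : M.IsSymm)
    (hMpsd : ∀ c : Fin n → ℝ, 0 ≤ ∑ i, ∑ j, c i * M i j * c j)
    (hMM : M * M = L)
    (W S : (Fin n → EuclideanSpace ℝ (Fin p)) → (Fin n → EuclideanSpace ℝ (Fin p)))
    (hW : ∀ (u : Fin n → EuclideanSpace ℝ (Fin p)) (i : Fin n), W u i = ∑ j, L i j • u j)
    (hS : ∀ (u : Fin n → EuclideanSpace ℝ (Fin p)) (i : Fin n), S u i = ∑ j, M i j • u j)
    {η ρ : ℝ} (hη : 0 < η) (hρ : 0 < ρ)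
    (Ω : (Fin n → EuclideanSpace ℝ (Fin p)) → (Fin n → EuclideanSpace ℝ (Fin p)))
    (hΩdef : ∀ u : Fin n → EuclideanSpace ℝ (Fin p), Ω u = η • u - ρ • W u)
    (X : Fin n → Set (EuclideanSpace ℝ (Fin p)))
    (hXne : ∀ i, (X i).Nonempty) (hXcl : ∀ i, IsClosed (X i)) (hXconv : ∀ i, Convex ℝ (X i))
    (f : Fin n → EuclideanSpace ℝ (Fin p) → ℝ)
    (hfconv : ∀ i, ConvexOn ℝ Set.univ (f i))
    (d : Fin n → EuclideanSpace ℝ (Fin p))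
    (x y v : ℕ → Fin n → EuclideanSpace ℝ (Fin p))
    (hxX : ∀ (k : ℕ) (i : Fin n), x (k+1) i ∈ X i)
    (hstep : ∀ (k : ℕ) (i : Fin n), ∀ ξ ∈ X i,
      f i (x (k+1) i)
          + (η/2) * ‖y k i + η⁻¹ • (x (k+1) i - d i + S (v k) i - ρ • W (y k) i)‖^2
        ≤ f i ξ + (η/2) * ‖y k i + η⁻¹ • (ξ - d i + S (v k) i - ρ • W (y k) i)‖^2)
    (hy : ∀ k : ℕ, y (k+1) = y k + η⁻¹ • (x (k+1) - d + S (v k) - ρ • W (y k)))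
    (hv : ∀ k : ℕ, v (k+1) = v k - ρ • S (y (k+1)))
    :
    ∀ k : ℕ, ∀ x' : Fin n → EuclideanSpace ℝ (Fin p), (∀ i, x' i ∈ X i) →
      (∑ i, f i (x (k+1) i)) + (∑ i, ⟪y (k+1) i, x (k+1) i⟫) ≤
        (∑ i, f i (x' i)) + ∑ i, ⟪y (k+1) i, x' i⟫ := by
  intro k x' hx'
  rw [← Finset.sum_add_distrib, ← Finset.sum_add_distrib]
  refine Finset.sum_le_sum fun i _ ↦ ?_
  have hyi : y (k+1) i = y k i + η⁻¹ • (x (k+1) i - d i + S (v k) i - ρ • W (y k) i) := by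
    rw [hy k]
    rfl
  refine ((hfconv i).subset (Set.subset_univ _) (hXconv i)).add_inner_le_of_isMin_add_sq hη
    (hxX k i) (fun ξ hξ ↦ ?_) (hx' i)
  have hshift : y (k+1) i + η⁻¹ • (ξ - x (k+1) i) =
      y k i + η⁻¹ • (ξ - d i + S (v k) i - ρ • W (y k) i) := by
    rw [hyi]
    module
  rw [hshift, hyi]
  exact hstep k i ξ hξ
end

section
/- For every k ≥ 0, the pairing of the primal error with the optimal dual variable is controlled by the dual increment: |⟪x* − x_{k+1}, y*⟫| ≤ ‖y*‖_Ω · ‖y_{k+1} − y_k‖_Ω, where Ω := η·id − ρ·W. -/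
open scoped RealInnerProductSpace

open scoped Matrix in
/-- A symmetric real matrix whose square has zero row sums has zero row sums. -/
theorem Matrix.sum_row_eq_zero_of_mul_self {n : ℕ} {L M : Matrix (Fin n) (Fin n) ℝ}
    (hM : M.IsSymm) (hMM : M * M = L) (hL : ∀ i, ∑ j, L i j = 0) (i : Fin n) :
    ∑ j, M i j = 0 := by
  have h1 : L *ᵥ (fun _ => 1) = 0 := by
    ext i
    simpa [Matrix.mulVec, dotProduct] using hL i
  have h2 : M *ᵥ (fun _ => 1) = 0 := by
    rw [← hMM] at h1
    nth_rewrite 1 [← hM.eq] at h1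
    rw [← Matrix.conjTranspose_eq_transpose_of_trivial] at h1
    exact Matrix.conjTranspose_mul_self_mulVec_eq_zero M _ |>.mp h1
  simpa [Matrix.mulVec, dotProduct] using congrFun h2 i

/-- The blockwise action of a symmetric matrix with zero row sums has zero total. -/
theorem Matrix.sum_sum_smul_eq_zero {n : ℕ} {V : Type*} [AddCommGroup V] [Module ℝ V]
    {A : Matrix (Fin n) (Fin n) ℝ} (hA : A.IsSymm) (hrow : ∀ i, ∑ j, A i j = 0)
    (u : Fin n → V) : ∑ i, ∑ j, A i j • u j = 0 := by
  rw [Finset.sum_comm]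
  refine Finset.sum_eq_zero fun j _ => ?_
  rw [← Finset.sum_smul, Finset.sum_congr rfl fun i _ => hA.apply j i, hrow, zero_smul]

/-- CONTEXT: economic dispatch via dual consensus; E = ℝ^p, variables in Eⁿ. -/
theorem stmt_13
    {n p : ℕ} (hn : 1 ≤ n) (hp : 1 ≤ p)
    (L M : Matrix (Fin n) (Fin n) ℝ)
    (hLsymm : L.IsSymm)
    (hLpsd : ∀ c : Fin n → ℝ, 0 ≤ ∑ i, ∑ j, c i * L i j * c j)
    (hLrow : ∀ i : Fin n, ∑ j, L i j = 0)
    (hMsymm : M.IsSymm)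
    (hMpsd : ∀ c : Fin n → ℝ, 0 ≤ ∑ i, ∑ j, c i * M i j * c j)
    (hMM : M * M = L)
    (W S : (Fin n → EuclideanSpace ℝ (Fin p)) → (Fin n → EuclideanSpace ℝ (Fin p)))
    (hW : ∀ (u : Fin n → EuclideanSpace ℝ (Fin p)) (i : Fin n), W u i = ∑ j, L i j • u j)
    (hS : ∀ (u : Fin n → EuclideanSpace ℝ (Fin p)) (i : Fin n), S u i = ∑ j, M i j • u j)
    {η ρ : ℝ} (hη : 0 < η) (hρ : 0 < ρ)
    (Ω : (Fin n → EuclideanSpace ℝ (Fin p)) → (Fin n → EuclideanSpace ℝ (Fin p)))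
    (hΩdef : ∀ u : Fin n → EuclideanSpace ℝ (Fin p), Ω u = η • u - ρ • W u)
    (hΩpd : ∀ u : Fin n → EuclideanSpace ℝ (Fin p), u ≠ 0 → 0 < ∑ i, ⟪u i, Ω u i⟫)
    (X : Fin n → Set (EuclideanSpace ℝ (Fin p)))
    (hXne : ∀ i, (X i).Nonempty) (hXcl : ∀ i, IsClosed (X i)) (hXconv : ∀ i, Convex ℝ (X i))
    (f : Fin n → EuclideanSpace ℝ (Fin p) → ℝ)
    (hfconv : ∀ i, ConvexOn ℝ Set.univ (f i))
    (d : Fin n → EuclideanSpace ℝ (Fin p))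
    (x y v : ℕ → Fin n → EuclideanSpace ℝ (Fin p))
    (hxX : ∀ (k : ℕ) (i : Fin n), x (k+1) i ∈ X i)
    (hstep : ∀ (k : ℕ) (i : Fin n), ∀ ξ ∈ X i,
      f i (x (k+1) i)
          + (η/2) * ‖y k i + η⁻¹ • (x (k+1) i - d i + S (v k) i - ρ • W (y k) i)‖^2
        ≤ f i ξ + (η/2) * ‖y k i + η⁻¹ • (ξ - d i + S (v k) i - ρ • W (y k) i)‖^2)
    (hy : ∀ k : ℕ, y (k+1) = y k + η⁻¹ • (x (k+1) - d + S (v k) - ρ • W (y k)))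
    (hv : ∀ k : ℕ, v (k+1) = v k - ρ • S (y (k+1)))
    (xstar : Fin n → EuclideanSpace ℝ (Fin p)) (δstar : EuclideanSpace ℝ (Fin p))
    (hxstarX : ∀ i, xstar i ∈ X i)
    (hbal : ∑ i, (xstar i - d i) = 0)
    (ystar : Fin n → EuclideanSpace ℝ (Fin p)) (hystar : ystar = fun _ => δstar)
    (hsaddle : ∀ x' : Fin n → EuclideanSpace ℝ (Fin p), (∀ i, x' i ∈ X i) →
      (∑ i, f i (xstar i)) - ∑ i, ⟪ystar i, x' i - xstar i⟫ ≤ ∑ i, f i (x' i))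
    :
    ∀ k : ℕ,
      |∑ i, ⟪xstar i - x (k+1) i, ystar i⟫| ≤
        Real.sqrt (∑ i, ⟪ystar i, Ω ystar i⟫) *
          Real.sqrt (∑ i, ⟪(y (k+1) - y k) i, Ω (y (k+1) - y k) i⟫) := by
  intro k
  have hMrow := Matrix.sum_row_eq_zero_of_mul_self hMsymm hMM hLrow
  have hWsum : ∀ u, ∑ i, W u i = 0 := fun u => by
    simpa only [hW] using Matrix.sum_sum_smul_eq_zero hLsymm hLrow u
  have hSsum : ∀ u, ∑ i, S u i = 0 := fun u => by
    simpa only [hS] using Matrix.sum_sum_smul_eq_zero hMsymm hMrow u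
  subst hystar
  set Δ := y (k+1) - y k with hΔ
  have hincr : ∀ i, η • Δ i = x (k+1) i - d i + S (v k) i - ρ • W (y k) i := fun i => by
    rw [hΔ, hy k, add_sub_cancel_left]
    simp [smul_smul, hη.ne']
  have htotal : η • ∑ i, Δ i = ∑ i, (x (k+1) i - xstar i) := by
    rw [Finset.smul_sum, Finset.sum_congr rfl fun i _ => hincr i]
    simp only [Finset.sum_sub_distrib, Finset.sum_add_distrib, ← Finset.smul_sum, hSsum,
      hWsum] at hbal ⊢
    rw [sub_eq_zero.mp hbal]
    simp
  have hΩ : ∀ u i, Ω u i = η • u i - ρ • W u i := fun u i => by rw [hΩdef]; rfl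
  have hΩsum : ∑ i, Ω Δ i = η • ∑ i, Δ i := by
    simp only [hΩ, Finset.sum_sub_distrib, ← Finset.smul_sum, hWsum, smul_zero, sub_zero]
  have hΩconst : ∀ i, Ω (fun _ => δstar) i = η • δstar := fun i => by
    rw [hΩ, hW, ← Finset.sum_smul, hLrow, zero_smul, smul_zero, sub_zero]
  have hΩshift : ∀ (t : ℝ) i, Ω (fun j => Δ j + t • δstar) i = Ω Δ i + (t * η) • δstar := by
    intro t i
    have hWshift : W (fun j => Δ j + t • δstar) i = W Δ i := by
      rw [hW, hW]
      simp only [smul_add, Finset.sum_add_distrib, ← Finset.sum_smul, hLrow, zero_smul, add_zero]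
    rw [hΩ, hΩ, hWshift, smul_add, smul_smul, mul_comm t η]
    abel
  have hnonneg : ∀ u : Fin n → EuclideanSpace ℝ (Fin p), 0 ≤ ∑ i, ⟪u i, Ω u i⟫ := fun u => by
    rcases eq_or_ne u 0 with rfl | hu
    · simp
    · exact (hΩpd u hu).le
  have hpair : ∑ i, ⟪xstar i - x (k+1) i, δstar⟫ = -(η * ⟪∑ i, Δ i, δstar⟫) := by
    rw [← real_inner_smul_left, htotal, ← sum_inner, ← inner_neg_left, ← Finset.sum_neg_distrib]
    simp only [neg_sub]
  have hquad : ∀ t : ℝ, 0 ≤ (∑ _i : Fin n, ⟪δstar, η • δstar⟫) * (t * t) +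
      2 * (η * ⟪∑ i, Δ i, δstar⟫) * t + ∑ i, ⟪Δ i, Ω Δ i⟫ := fun t => by
    have h := hnonneg fun j => Δ j + t • δstar
    simp only [hΩshift, inner_add_left, inner_add_right, Finset.sum_add_distrib,
      real_inner_smul_left, real_inner_smul_right, ← Finset.mul_sum, ← sum_inner, ← inner_sum,
      hΩsum] at h ⊢
    rw [real_inner_comm (∑ i, Δ i) δstar] at h
    linarith
  have hdiscrim := discrim_le_zero hquad
  rw [discrim] at hdiscrim
  simp only [hΩconst]
  rw [hpair, abs_neg, ← Real.sqrt_mul (by simpa only [hΩconst] using hnonneg fun _ => δstar)]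
  apply Real.abs_le_sqrt
  linarith
end
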